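/- arXiv:1806.01149 — 7 statements merged into one kernel-verified Lean document; each statement's English description precedes it below -/
import Mathlib

section
/- Let p be a prime number. Then the limit as m → ∞ of (∑_{k=1}^m φ(p·k)) / (p·m)² equals 3 / ((p+1)·π²). -/
open Filter Finset Real

/-- If `F n / n ^ 2` tends to `c` and is bounded, then the hyperbola-type sums
`∑ a i * F (m / d i)` are asymptotic to `c * ∑ a i / d i ^ 2 * m ^ 2`. -/
theorem tendsto_tsum_mul_natDiv_div_sq {ι : Type*} {F : ℕ → ℝ} {c C : ℝ} (a : ι → ℝ) (d : ι → ℕ)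
    (hF : Tendsto (fun n : ℕ => F n / (n : ℝ) ^ 2) atTop (nhds c))
    (hC : ∀ n : ℕ, |F n| ≤ C * (n : ℝ) ^ 2)
    (ha : Summable fun i => |a i| / (d i : ℝ) ^ 2) :
    Tendsto (fun m : ℕ => (∑' i, a i * F (m / d i)) / (m : ℝ) ^ 2) atTop
      (nhds (c * ∑' i, a i / (d i : ℝ) ^ 2)) := by
  have hF0 : F 0 = 0 := by simpa using hC 0
  have hC0 : 0 ≤ C := by simpa using (abs_nonneg _).trans (hC 1)
  simp_rw [← tsum_div_const, ← tsum_mul_left]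
  refine tendsto_tsum_of_dominated_convergence (ha.mul_left C) (fun i => ?_)
    (Eventually.of_forall fun m i => ?_)
  · rcases Nat.eq_zero_or_pos (d i) with h0 | hpos
    · simp [h0, hF0]
    have hlim : Tendsto (fun m : ℕ => ((m / d i : ℕ) : ℝ) / m) atTop (nhds (d i : ℝ)⁻¹) := by
      have := (tendsto_nat_floor_mul_div_atTop (R := ℝ) (a := (d i : ℝ)⁻¹)
        (by positivity)).comp tendsto_natCast_atTop_atTop
      refine this.congr fun m => ?_
      simp only [Function.comp_apply]
      rw [inv_mul_eq_div, Nat.floor_div_eq_div]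
    have hdiv : Tendsto (fun m : ℕ => m / d i) atTop atTop := Nat.tendsto_div_const_atTop hpos.ne'
    have h := ((hF.comp hdiv).mul (hlim.pow 2)).const_mul (a i)
    rw [show c * (a i / (d i : ℝ) ^ 2) = a i * (c * (d i : ℝ)⁻¹ ^ 2) by
      rw [inv_pow, div_eq_mul_inv]; ring]
    refine h.congr' ?_
    filter_upwards [hdiv.eventually_gt_atTop 0] with m hm
    have : ((m / d i : ℕ) : ℝ) ≠ 0 := by exact_mod_cast hm.ne'
    simp only [Function.comp_apply]
    field_simp
  · have hle : ((m / d i : ℕ) : ℝ) ≤ m / d i := Nat.cast_div_le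
    rw [Real.norm_eq_abs, abs_div, abs_mul, abs_of_nonneg (sq_nonneg (m : ℝ))]
    rcases Nat.eq_zero_or_pos m with rfl | hm
    · simpa using by positivity
    have hm' : (0 : ℝ) < m := by exact_mod_cast hm
    rw [div_le_iff₀ (by positivity)]
    calc |a i| * |F (m / d i)| ≤ |a i| * (C * (m / d i : ℝ) ^ 2) := by
          gcongr
          exact (hC _).trans (by gcongr)
      _ = C * (|a i| / (d i : ℝ) ^ 2) * (m : ℝ) ^ 2 := by rw [div_pow]; ring

theorem sum_Icc_totient_le_sq (n : ℕ) : |∑ k ∈ Icc 1 n, (Nat.totient k : ℝ)| ≤ 1 * (n : ℝ) ^ 2 := by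
  rw [abs_of_nonneg (by positivity), one_mul]
  calc ∑ k ∈ Icc 1 n, (Nat.totient k : ℝ) ≤ ∑ k ∈ Icc 1 n, (n : ℝ) := by
        refine sum_le_sum fun k hk => ?_
        exact_mod_cast (Nat.totient_le k).trans (mem_Icc.1 hk).2
    _ = (n : ℝ) ^ 2 := by simp [sq]

theorem sum_Icc_natCast_eq (n : ℕ) : ∑ k ∈ Icc 1 n, (k : ℝ) = n * (n + 1) / 2 := by
  induction n with
  | zero => simp
  | succ n ih => rw [sum_Icc_succ_top (by omega), ih]; push_cast; ring

theorem totient_eq_sum_moebius_mul {n : ℕ} (hn : 0 < n) :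
    (Nat.totient n : ℝ) =
      ∑ x ∈ n.divisorsAntidiagonal, (ArithmeticFunction.moebius x.1 : ℝ) * (x.2 : ℝ) :=
  ((ArithmeticFunction.sum_eq_iff_sum_mul_moebius_eq (R := ℝ) (f := fun n => (Nat.totient n : ℝ))
    (g := fun n => (n : ℝ))).1 (fun n _ => by exact_mod_cast Nat.sum_totient n) n hn).symm

theorem sum_Icc_totient_eq_tsum (m : ℕ) :
    ∑ k ∈ Icc 1 m, (Nat.totient k : ℝ) =
      ∑' d : ℕ, (ArithmeticFunction.moebius d : ℝ) * ∑ k ∈ Icc 1 (m / d), (k : ℝ) := by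
  have h := ArithmeticFunction.sum_Ioc_mul_eq_sum_sum
    (ArithmeticFunction.moebius : ArithmeticFunction ℝ)
    (ArithmeticFunction.id : ArithmeticFunction ℝ) m
  rw [tsum_eq_sum (s := Icc 1 m)]
  · refine Eq.trans (sum_congr rfl fun k hk => ?_) h
    rw [totient_eq_sum_moebius_mul (mem_Icc.1 hk).1]
    simp [ArithmeticFunction.mul_apply]
  · intro d hd
    rcases Nat.eq_zero_or_pos d with rfl | hpos
    · simp
    have : m / d = 0 := Nat.div_eq_of_lt (by simp at hd; omega)
    simp [this]

theorem summable_abs_moebius_div_sq :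
    Summable fun d : ℕ => |(ArithmeticFunction.moebius d : ℝ)| / (d : ℝ) ^ 2 := by
  refine (Real.summable_one_div_nat_pow.2 one_lt_two).of_nonneg_of_le
    (fun d => by positivity) fun d => ?_
  gcongr
  exact_mod_cast ArithmeticFunction.abs_moebius_le_one

theorem tsum_moebius_div_sq :
    ∑' d : ℕ, (ArithmeticFunction.moebius d : ℝ) / (d : ℝ) ^ 2 = 6 / π ^ 2 := by
  have h2 : 1 < (2 : ℂ).re := by norm_num
  have h := ArithmeticFunction.LSeries_zeta_mul_Lseries_moebius h2
  rw [ArithmeticFunction.LSeries_zeta_eq_riemannZeta h2, riemannZeta_two] at h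
  have hL : LSeries (fun n => (ArithmeticFunction.moebius n : ℂ)) 2 =
      ((∑' d : ℕ, (ArithmeticFunction.moebius d : ℝ) / (d : ℝ) ^ 2 : ℝ) : ℂ) := by
    rw [LSeries, Complex.ofReal_tsum]
    refine tsum_congr fun d => ?_
    rcases eq_or_ne d 0 with rfl | hd
    · simp
    · rw [LSeries.term_of_ne_zero hd]
      push_cast
      norm_cast
  rw [hL] at h
  have h' : π ^ 2 / 6 * ∑' d : ℕ, (ArithmeticFunction.moebius d : ℝ) / (d : ℝ) ^ 2 = 1 := by
    exact_mod_cast h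
  field_simp at h' ⊢
  linarith

theorem tendsto_sum_Icc_natCast_div_sq :
    Tendsto (fun n : ℕ => (∑ k ∈ Icc 1 n, (k : ℝ)) / (n : ℝ) ^ 2) atTop (nhds (1 / 2)) := by
  have h : Tendsto (fun n : ℕ => (1 + 1 / (n : ℝ)) / 2) atTop (nhds ((1 + 0) / 2)) :=
    (tendsto_one_div_atTop_nhds_zero_nat.const_add 1).div_const 2
  rw [add_zero] at h
  refine h.congr' ?_
  filter_upwards [eventually_gt_atTop 0] with n hn
  have : (n : ℝ) ≠ 0 := by exact_mod_cast hn.ne'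
  rw [sum_Icc_natCast_eq]
  field_simp

/-- The mean value of Euler's totient function. -/
theorem tendsto_sum_Icc_totient_div_sq :
    Tendsto (fun m : ℕ => (∑ k ∈ Icc 1 m, (Nat.totient k : ℝ)) / (m : ℝ) ^ 2) atTop
      (nhds (3 / π ^ 2)) := by
  have h := tendsto_tsum_mul_natDiv_div_sq (C := 1)
    (fun d : ℕ => (ArithmeticFunction.moebius d : ℝ)) (fun d => d)
    tendsto_sum_Icc_natCast_div_sq (fun n => ?_) summable_abs_moebius_div_sq
  · simp_rw [sum_Icc_totient_eq_tsum]
    rw [tsum_moebius_div_sq] at h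
    convert! h using 2
    ring
  · rw [abs_of_nonneg (by positivity), sum_Icc_natCast_eq]
    have : (n : ℝ) ≤ (n : ℝ) ^ 2 := by exact_mod_cast Nat.le_self_pow two_ne_zero n
    linarith

theorem sum_Icc_filter_dvd {M : Type*} [AddCommMonoid M] {p : ℕ} (hp : 0 < p) (m : ℕ)
    (f : ℕ → M) : ∑ k ∈ Icc 1 m with p ∣ k, f k = ∑ k ∈ Icc 1 (m / p), f (p * k) := by
  symm
  refine sum_bij (fun k _ => p * k) (fun k hk => ?_) (fun a _ b _ h => ?_) (fun k hk => ?_)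
    fun _ _ => rfl
  · rw [mem_Icc, Nat.le_div_iff_mul_le hp] at hk
    rw [mem_filter, mem_Icc, mul_comm]
    exact ⟨⟨Nat.mul_pos hk.1 hp, hk.2⟩, dvd_mul_left _ _⟩
  · exact Nat.eq_of_mul_eq_mul_left hp h
  · obtain ⟨hk, j, rfl⟩ := mem_filter.1 hk
    rw [mem_Icc] at hk
    refine ⟨j, mem_Icc.2 ⟨Nat.pos_of_mul_pos_left hk.1, ?_⟩, rfl⟩
    rw [Nat.le_div_iff_mul_le hp, mul_comm]
    exact hk.2

theorem sum_Icc_totient_prime_mul {p : ℕ} (hp : p.Prime) (m : ℕ) :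
    ∑ k ∈ Icc 1 m, (Nat.totient (p * k) : ℝ) =
      ((p : ℝ) - 1) * ∑ k ∈ Icc 1 m, (Nat.totient k : ℝ) +
        ∑ k ∈ Icc 1 (m / p), (Nat.totient (p * k) : ℝ) := by
  rw [← sum_Icc_filter_dvd hp.pos m fun k => (Nat.totient k : ℝ), sum_filter, mul_sum,
    ← sum_add_distrib]
  refine sum_congr rfl fun k _ => ?_
  split_ifs with h
  · rw [Nat.totient_mul_of_prime_of_dvd hp h]
    push_cast
    ring
  · rw [Nat.totient_mul_of_prime_of_not_dvd hp h]
    push_cast [hp.one_le]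
    ring

theorem sum_Icc_totient_prime_mul_eq_tsum {p : ℕ} (hp : p.Prime) (m : ℕ) :
    ∑ k ∈ Icc 1 m, (Nat.totient (p * k) : ℝ) =
      ∑' j : ℕ, ((p : ℝ) - 1) * ∑ k ∈ Icc 1 (m / p ^ j), (Nat.totient k : ℝ) := by
  have hN (N : ℕ) : ∑ k ∈ Icc 1 m, (Nat.totient (p * k) : ℝ) =
      ∑ j ∈ range N, ((p : ℝ) - 1) * ∑ k ∈ Icc 1 (m / p ^ j), (Nat.totient k : ℝ) +
        ∑ k ∈ Icc 1 (m / p ^ N), (Nat.totient (p * k) : ℝ) := by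
    induction N with
    | zero => simp
    | succ N ih =>
      rw [ih, sum_Icc_totient_prime_mul hp (m / p ^ N), sum_range_succ, Nat.div_div_eq_div_mul,
        ← pow_succ]
      ring
  have h0 {j : ℕ} (hj : m ≤ j) : m / p ^ j = 0 :=
    Nat.div_eq_of_lt (hj.trans_lt (Nat.lt_pow_self hp.one_lt))
  rw [hN m, h0 le_rfl, tsum_eq_sum (s := range m)]
  · simp
  · intro j hj
    simp [h0 (not_lt.1 (mem_range.not.1 hj))]

theorem phi_sum_multiples_of_prime_limit (p : ℕ) (hp : p.Prime) :
    Tendsto (fun m : ℕ =>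
        (∑ k ∈ Finset.Icc 1 m, (Nat.totient (p * k) : ℝ)) / ((p : ℝ) * m) ^ 2)
      atTop (nhds (3 / (((p : ℝ) + 1) * π ^ 2))) := by
  have hp1 : (1 : ℝ) < p := by exact_mod_cast hp.one_lt
  have hlt : ((p : ℝ) ^ 2)⁻¹ < 1 := inv_lt_one_of_one_lt₀ (one_lt_pow₀ hp1 two_ne_zero)
  have hgeom (b : ℝ) : HasSum (fun j : ℕ => b / ((p ^ j : ℕ) : ℝ) ^ 2)
      (b * (1 - ((p : ℝ) ^ 2)⁻¹)⁻¹) := by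
    refine ((hasSum_geometric_of_lt_one (by positivity) hlt).mul_left b).congr_fun fun j => ?_
    push_cast
    rw [← pow_mul, mul_comm j, pow_mul, inv_pow, div_eq_mul_inv]
  have h := (tendsto_tsum_mul_natDiv_div_sq (fun _ : ℕ => (p : ℝ) - 1) (fun j => p ^ j)
    tendsto_sum_Icc_totient_div_sq sum_Icc_totient_le_sq (hgeom _).summable).div_const
      ((p : ℝ) ^ 2)
  rw [(hgeom _).tsum_eq] at h
  simp_rw [sum_Icc_totient_prime_mul_eq_tsum hp]
  convert! h using 2
  · rw [mul_pow, div_div, mul_comm]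
  · have h1 : (p : ℝ) ^ 2 - 1 ≠ 0 := by nlinarith
    have h2 : (p : ℝ) + 1 ≠ 0 := by linarith
    field_simp
    ring
end

section
/- Let p be a prime number and let Φ_{r₀}(n) = ∑_{k : p·k ≤ n} φ(p·k) denote the sum of φ over the multiples of p not exceeding n. Then Φ_{r₀}(n) = 3·n² / ((p+1)·π²) + O(n·log n) as n → ∞. -/
open Filter Finset Real

open ArithmeticFunction in
lemma totient_cast_eq_moebius_mul (n : ℕ) :
    (Nat.totient n : ℝ) = ((moebius : ArithmeticFunction ℝ) *
      ((ArithmeticFunction.id : ArithmeticFunction ℕ) : ArithmeticFunction ℝ)) n := by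
  rcases Nat.eq_zero_or_pos n with rfl | hn
  · simp
  · have h := (sum_eq_iff_sum_mul_moebius_eq (R := ℝ) (f := fun n ↦ (Nat.totient n : ℝ))
      (g := fun n ↦ (n : ℝ))).1 (fun n _ ↦ by exact_mod_cast Nat.sum_totient n) n hn
    rw [← h, mul_apply]
    simp

lemma sum_Ioc_cast_id (q : ℕ) : ∑ m ∈ Ioc 0 q, (m : ℝ) = q * (q + 1) / 2 := by
  induction q with
  | zero => simp
  | succ q ih =>
    rw [Finset.sum_Ioc_succ_top (Nat.zero_le q), ih]
    push_cast
    ring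

open ArithmeticFunction in
lemma sum_totient_eq_sum_moebius (n : ℕ) :
    ∑ k ∈ Ioc 0 n, (Nat.totient k : ℝ) =
      ∑ d ∈ Ioc 0 n, (moebius d : ℝ) * (((n / d : ℕ) : ℝ) * ((n / d : ℕ) + 1) / 2) := by
  simp_rw [totient_cast_eq_moebius_mul, sum_Ioc_mul_eq_sum_sum, ← sum_Ioc_cast_id]
  simp

open ArithmeticFunction in
lemma hasSum_moebius_div_sq :
    HasSum (fun d : ℕ ↦ (moebius d : ℝ) / (d : ℝ) ^ 2) (6 / π ^ 2) := by
  have h2 : (1 : ℝ) < (2 : ℂ).re := by norm_num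
  have hs := (LSeriesSummable_moebius_iff.2 h2).LSeriesHasSum
  have hL : LSeries (fun n ↦ ((moebius n : ℤ) : ℂ)) 2 = ((6 / π ^ 2 : ℝ) : ℂ) := by
    have h := LSeries_one_mul_Lseries_moebius h2
    rw [LSeries_one_eq_riemannZeta h2, riemannZeta_two] at h
    have hpi : (π : ℂ) ≠ 0 := by exact_mod_cast pi_ne_zero
    push_cast
    field_simp at h ⊢
    linear_combination h
  rw [hL] at hs
  rw [← Complex.hasSum_ofReal]
  refine hs.congr_fun ?_
  intro d
  rcases eq_or_ne d 0 with rfl | hd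
  · simp
  · rw [LSeries.term_def, if_neg hd]
    push_cast
    norm_cast

open ArithmeticFunction in
lemma abs_sum_moebius_div_sq_sub_le {n : ℕ} (hn : n ≠ 0) :
    |∑ d ∈ Ioc 0 n, (moebius d : ℝ) / (d : ℝ) ^ 2 - 6 / π ^ 2| ≤ 1 / (n : ℝ) := by
  have hsum : ∀ m : ℕ, ∑ d ∈ Finset.range (m + 1), (moebius d : ℝ) / (d : ℝ) ^ 2 =
      ∑ d ∈ Ioc 0 m, (moebius d : ℝ) / (d : ℝ) ^ 2 := by
    intro m
    induction m with
    | zero => simp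
    | succ m ih => rw [Finset.sum_range_succ, ih, Finset.sum_Ioc_succ_top (Nat.zero_le m)]
  have ht := (hasSum_moebius_div_sq.tendsto_sum_nat.comp (tendsto_add_atTop_nat 1))
  simp only [Function.comp_def, hsum] at ht
  have ht' := (ht.const_sub (∑ d ∈ Ioc 0 n, (moebius d : ℝ) / (d : ℝ) ^ 2)).abs
  refine le_of_tendsto ht' ?_
  filter_upwards [eventually_ge_atTop n] with m hm
  rw [← Finset.sum_Ioc_consecutive _ (Nat.zero_le n) hm, sub_add_cancel_left, abs_neg]
  calc |∑ d ∈ Ioc n m, (moebius d : ℝ) / (d : ℝ) ^ 2|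
      ≤ ∑ d ∈ Ioc n m, |(moebius d : ℝ) / (d : ℝ) ^ 2| := abs_sum_le_sum_abs _ _
    _ ≤ ∑ d ∈ Ioc n m, ((d : ℝ) ^ 2)⁻¹ := by
        refine sum_le_sum fun d _ ↦ ?_
        have h : |(moebius d : ℝ)| ≤ 1 := by exact_mod_cast abs_moebius_le_one
        rw [abs_div, abs_of_nonneg (sq_nonneg (d : ℝ)), div_eq_mul_inv]
        exact mul_le_of_le_one_left (by positivity) h
    _ ≤ (n : ℝ)⁻¹ - (m : ℝ)⁻¹ := sum_Ioc_inv_sq_le_sub hn hm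
    _ ≤ 1 / n := by
        rw [one_div]
        exact sub_le_self _ (by positivity)

lemma sum_Ioc_inv_le_one_add_log (n : ℕ) : ∑ d ∈ Ioc 0 n, (d : ℝ)⁻¹ ≤ 1 + log n := by
  have h := harmonic_le_one_add_log n
  rw [harmonic_eq_sum_Icc] at h
  push_cast at h
  exact h

lemma natCast_div_lt_add_one (n d : ℕ) : (n : ℝ) / d < (n / d : ℕ) + 1 := by
  rw [← Nat.floor_div_eq_div (K := ℝ)]
  exact Nat.lt_floor_add_one _

lemma abs_triangular_div_sub_le (n d : ℕ) :
    |((n / d : ℕ) : ℝ) * ((n / d : ℕ) + 1) / 2 - ((n : ℝ) / d) ^ 2 / 2| ≤ (n : ℝ) / d / 2 := by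
  have hle : ((n / d : ℕ) : ℝ) ≤ (n : ℝ) / d := Nat.cast_div_le
  have hlt : (n : ℝ) / d < (n / d : ℕ) + 1 := natCast_div_lt_add_one n d
  have h0 : (0 : ℝ) ≤ (n / d : ℕ) := Nat.cast_nonneg _
  generalize ((n / d : ℕ) : ℝ) = q at *
  generalize (n : ℝ) / d = x at *
  rw [abs_le]
  constructor <;> nlinarith

open ArithmeticFunction hiding log in
/-- The average order of Euler's totient function. -/
theorem abs_sum_totient_sub_le (n : ℕ) :
    |∑ k ∈ Ioc 0 n, (Nat.totient k : ℝ) - 3 / π ^ 2 * (n : ℝ) ^ 2| ≤ (n : ℝ) * (1 + log n) := by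
  rcases eq_or_ne n 0 with rfl | hn
  · simp
  have hn0 : (0 : ℝ) < n := by positivity
  have hlog : 0 ≤ log (n : ℝ) := log_natCast_nonneg n
  have hmain : |∑ k ∈ Ioc 0 n, (Nat.totient k : ℝ) -
      (n : ℝ) ^ 2 / 2 * ∑ d ∈ Ioc 0 n, (moebius d : ℝ) / (d : ℝ) ^ 2| ≤
      (n : ℝ) / 2 * (1 + log n) := by
    rw [sum_totient_eq_sum_moebius, mul_sum, ← sum_sub_distrib]
    calc _ ≤ ∑ d ∈ Ioc 0 n, (n : ℝ) / 2 * (d : ℝ)⁻¹ := by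
          refine (abs_sum_le_sum_abs _ _).trans (sum_le_sum fun d _ ↦ ?_)
          have h : |(moebius d : ℝ)| ≤ 1 := by exact_mod_cast abs_moebius_le_one
          calc _ = |(moebius d : ℝ)| * |((n / d : ℕ) : ℝ) * ((n / d : ℕ) + 1) / 2 -
                ((n : ℝ) / d) ^ 2 / 2| := by
                rw [← abs_mul]
                congr 1
                ring
            _ ≤ 1 * ((n : ℝ) / d / 2) := by
                gcongr
                exact abs_triangular_div_sub_le n d
            _ = _ := by ring
      _ ≤ _ := by
          rw [← mul_sum]
          gcongr
          exact sum_Ioc_inv_le_one_add_log n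
  have htail : |(n : ℝ) ^ 2 / 2 * ∑ d ∈ Ioc 0 n, (moebius d : ℝ) / (d : ℝ) ^ 2 -
      3 / π ^ 2 * (n : ℝ) ^ 2| ≤ (n : ℝ) / 2 := by
    calc _ = (n : ℝ) ^ 2 / 2 *
          |∑ d ∈ Ioc 0 n, (moebius d : ℝ) / (d : ℝ) ^ 2 - 6 / π ^ 2| := by
          rw [← abs_of_nonneg (show (0 : ℝ) ≤ (n : ℝ) ^ 2 / 2 by positivity), ← abs_mul,
            abs_of_nonneg (show (0 : ℝ) ≤ (n : ℝ) ^ 2 / 2 by positivity)]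
          congr 1
          ring
      _ ≤ (n : ℝ) ^ 2 / 2 * (1 / n) := by
          gcongr
          exact abs_sum_moebius_div_sq_sub_le hn
      _ = _ := by field_simp
  refine (abs_sub_le _ _ _).trans ((add_le_add hmain htail).trans ?_)
  nlinarith [mul_nonneg hn0.le hlog]

lemma totient_prime_mul {p : ℕ} (hp : p.Prime) (k : ℕ) :
    (Nat.totient (p * k) : ℝ) =
      ((p : ℝ) - 1) * Nat.totient k + if p ∣ k then (Nat.totient k : ℝ) else 0 := by
  split_ifs with h
  · rw [Nat.totient_mul_of_prime_of_dvd hp h]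
    push_cast
    ring
  · rw [Nat.totient_mul_of_prime_of_not_dvd hp h, Nat.cast_mul, Nat.cast_pred hp.pos, add_zero]

lemma sum_Ioc_ite_dvd {M : Type*} [AddCommMonoid M] {p : ℕ} (hp : 0 < p) (f : ℕ → M) (m : ℕ) :
    (∑ k ∈ Ioc 0 m, if p ∣ k then f k else 0) = ∑ k ∈ Ioc 0 (m / p), f (p * k) := by
  rw [← sum_filter]
  symm
  refine sum_bij' (fun k _ ↦ p * k) (fun k _ ↦ k / p) ?_ ?_ ?_ ?_ ?_
  · intro k hk
    rw [mem_Ioc, Nat.le_div_iff_mul_le hp] at hk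
    simp only [mem_filter, mem_Ioc, dvd_mul_right, and_true]
    exact ⟨Nat.mul_pos hp hk.1, by linarith [mul_comm k p]⟩
  · intro k hk
    simp only [mem_filter, mem_Ioc] at hk
    exact mem_Ioc.2 ⟨Nat.div_pos (Nat.le_of_dvd hk.1.1 hk.2) hp, Nat.div_le_div_right hk.1.2⟩
  · intro k _
    exact Nat.mul_div_cancel_left k hp
  · intro k hk
    exact Nat.mul_div_cancel' (mem_filter.1 hk).2
  · intro k _
    rfl

lemma sum_totient_prime_mul {p : ℕ} (hp : p.Prime) (m : ℕ) :
    ∑ k ∈ Ioc 0 m, (Nat.totient (p * k) : ℝ) =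
      ((p : ℝ) - 1) * ∑ k ∈ Ioc 0 m, (Nat.totient k : ℝ) +
        ∑ k ∈ Ioc 0 (m / p), (Nat.totient (p * k) : ℝ) := by
  rw [← sum_Ioc_ite_dvd hp.pos (fun k ↦ (Nat.totient k : ℝ)), mul_sum, ← sum_add_distrib]
  exact sum_congr rfl fun k _ ↦ totient_prime_mul hp k

lemma abs_sq_natCast_div_sub_le (n p : ℕ) :
    |((n / p : ℕ) : ℝ) ^ 2 - ((n : ℝ) / p) ^ 2| ≤ 2 * ((n : ℝ) / p) := by
  have hle : ((n / p : ℕ) : ℝ) ≤ (n : ℝ) / p := Nat.cast_div_le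
  have hlt : (n : ℝ) / p < (n / p : ℕ) + 1 := natCast_div_lt_add_one n p
  have h0 : (0 : ℝ) ≤ (n / p : ℕ) := Nat.cast_nonneg _
  generalize ((n / p : ℕ) : ℝ) = q at *
  generalize (n : ℝ) / p = x at *
  rw [abs_le]
  constructor <;> nlinarith

lemma natCast_div_le_half {p : ℕ} (hp : 2 ≤ p) (m : ℕ) : (m : ℝ) / p ≤ m / 2 := by
  have : (2 : ℝ) ≤ p := by exact_mod_cast hp
  gcongr

lemma abs_sum_totient_prime_mul_sub_le {p : ℕ} (hp : p.Prime) {c : ℝ}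
    (hc : c = 3 * (p : ℝ) ^ 2 / (((p : ℝ) + 1) * π ^ 2)) (m : ℕ) :
    |∑ k ∈ Ioc 0 m, (Nat.totient (p * k) : ℝ) - c * (m : ℝ) ^ 2| ≤
      2 * ((p : ℝ) - 1 + c) * (m * (1 + log m)) := by
  have hp2 : (2 : ℝ) ≤ p := by exact_mod_cast hp.two_le
  have hc0 : 0 ≤ c := by rw [hc]; positivity
  induction m using Nat.strong_induction_on with
  | _ m ih =>
    rcases eq_or_ne m 0 with rfl | hm
    · simp
    have hm0 : (0 : ℝ) < m := by positivity
    have hlog : 0 ≤ log (m : ℝ) := log_natCast_nonneg m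
    have hcm : c * (m : ℝ) ^ 2 =
        ((p : ℝ) - 1) * (3 / π ^ 2 * (m : ℝ) ^ 2) + c * ((m : ℝ) / p) ^ 2 := by
      rw [hc]
      field_simp
      ring
    have hih := ih (m / p) (Nat.div_lt_self (Nat.pos_of_ne_zero hm) hp.one_lt)
    have hhalf := natCast_div_le_half hp.two_le m
    have hq : ((m / p : ℕ) : ℝ) ≤ m / 2 := Nat.cast_div_le.trans hhalf
    have hlogq : log ((m / p : ℕ) : ℝ) ≤ log m := by
      rcases Nat.eq_zero_or_pos (m / p) with h | h
      · simpa [h] using hlog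
      · exact log_le_log (by exact_mod_cast h) (by linarith)
    have hih' : |∑ k ∈ Ioc 0 (m / p), (Nat.totient (p * k) : ℝ) -
        c * ((m / p : ℕ) : ℝ) ^ 2| ≤ 2 * ((p : ℝ) - 1 + c) * (m / 2 * (1 + log m)) := by
      have : 0 ≤ log ((m / p : ℕ) : ℝ) := log_natCast_nonneg _
      have : 0 ≤ 2 * ((p : ℝ) - 1 + c) := by linarith
      refine hih.trans ?_
      gcongr
    have hF := mul_le_mul_of_nonneg_left (abs_sum_totient_sub_le m)
      (show (0 : ℝ) ≤ (p : ℝ) - 1 by linarith)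
    have hS := mul_le_mul_of_nonneg_left
      ((abs_sq_natCast_div_sub_le m p).trans (mul_le_mul_of_nonneg_left hhalf zero_le_two)) hc0
    rw [← abs_of_nonneg (show (0 : ℝ) ≤ (p : ℝ) - 1 by linarith), ← abs_mul,
      abs_of_nonneg (show (0 : ℝ) ≤ (p : ℝ) - 1 by linarith)] at hF
    rw [← abs_of_nonneg hc0, ← abs_mul, abs_of_nonneg hc0] at hS
    rw [sum_totient_prime_mul hp m, hcm]
    rw [abs_le] at *
    have := mul_nonneg hc0 (mul_nonneg hm0.le hlog)
    constructor <;> nlinarith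

theorem phi_sum_multiples_of_prime_asymptotic (p : ℕ) (hp : p.Prime) :
    ∃ C : ℝ, 0 < C ∧ ∃ N : ℕ, ∀ n : ℕ, N ≤ n →
      |(∑ k ∈ Finset.Icc 1 (n / p), (Nat.totient (p * k) : ℝ)) -
          3 * (n : ℝ) ^ 2 / (((p : ℝ) + 1) * π ^ 2)|
        ≤ C * n * Real.log n := by
  have hp2 : (2 : ℝ) ≤ p := by exact_mod_cast hp.two_le
  obtain ⟨c, hc⟩ : ∃ c : ℝ, c = 3 * (p : ℝ) ^ 2 / (((p : ℝ) + 1) * π ^ 2) := ⟨_, rfl⟩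
  have hc0 : 0 ≤ c := by rw [hc]; positivity
  refine ⟨2 * ((p : ℝ) - 1 + c) + c, by linarith, 3, fun n hn ↦ ?_⟩
  have hn0 : (0 : ℝ) < n := by exact_mod_cast (by omega : 0 < n)
  have hlog : 1 ≤ log (n : ℝ) := by
    rw [le_log_iff_exp_le hn0]
    have : (3 : ℝ) ≤ n := by exact_mod_cast hn
    linarith [exp_one_lt_d9]
  have hmain : 3 * (n : ℝ) ^ 2 / (((p : ℝ) + 1) * π ^ 2) = c * ((n : ℝ) / p) ^ 2 := by
    rw [hc]
    field_simp
  have hhalf := natCast_div_le_half hp.two_le n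
  have hq : ((n / p : ℕ) : ℝ) ≤ n / 2 := Nat.cast_div_le.trans hhalf
  have hlogq : log ((n / p : ℕ) : ℝ) ≤ log n := by
    rcases Nat.eq_zero_or_pos (n / p) with h | h
    · simpa [h] using zero_le_one.trans hlog
    · exact log_le_log (by exact_mod_cast h) (by linarith)
  have hG : |∑ k ∈ Ioc 0 (n / p), (Nat.totient (p * k) : ℝ) - c * ((n / p : ℕ) : ℝ) ^ 2| ≤
      2 * ((p : ℝ) - 1 + c) * (n / 2 * (log n + log n)) := by
    have : 0 ≤ log ((n / p : ℕ) : ℝ) := log_natCast_nonneg _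
    have : 0 ≤ 2 * ((p : ℝ) - 1 + c) := by linarith
    refine (abs_sum_totient_prime_mul_sub_le hp hc (n / p)).trans ?_
    gcongr
  have hS : |c * ((n / p : ℕ) : ℝ) ^ 2 - c * ((n : ℝ) / p) ^ 2| ≤ c * n * log n := by
    rw [← mul_sub, abs_mul, abs_of_nonneg hc0]
    calc _ ≤ c * (2 * ((n : ℝ) / 2)) := by
          gcongr
          exact (abs_sq_natCast_div_sub_le n p).trans (by gcongr)
      _ = c * n * 1 := by ring
      _ ≤ _ := by gcongr
  rw [hmain]
  refine (abs_sub_le _ _ _).trans ((add_le_add hG hS).trans_eq ?_)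
  ring
end

section
/- Let p be a prime number and let i be an integer with 1 ≤ i ≤ p−1. Then the limit as m → ∞ of (∑_{k=1}^m φ(p·k − i)) / (p·m)² equals 3·p / ((p² − 1)·π²). -/
open Filter Finset Real

open scoped ArithmeticFunction.Moebius

/-- A sequence whose increments over steps of length `d` at `m` lie between `c * m` and
`c * (m + d)` grows like `c * m ^ 2 / (2 * d)`. -/
lemma tendsto_div_sq_of_step {f : ℕ → ℝ} {d : ℕ} (hd : 0 < d) {c : ℝ}
    (hlow : ∀ m : ℕ, c * m ≤ f (m + d) - f m)
    (hupp : ∀ m : ℕ, f (m + d) - f m ≤ c * (m + d)) :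
    Tendsto (fun m : ℕ => f m / (m : ℝ) ^ 2) atTop (nhds (c / (2 * d))) := by
  have hd' : (0 : ℝ) < d := by exact_mod_cast hd
  have hc : 0 ≤ c := by
    have h1 := (hlow 0).trans (hupp 0)
    simp only [Nat.cast_zero, mul_zero, zero_add] at h1
    exact nonneg_of_mul_nonneg_left h1 hd'
  set g : ℕ → ℝ := fun m => 2 * d * f m - c * (m : ℝ) ^ 2 with hg
  set C : ℝ := ∑ j ∈ Finset.range d, |g j| with hC
  have hbound : ∀ m : ℕ, |g m| ≤ C + c * d * m := by
    intro m
    induction m using Nat.strong_induction_on with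
    | _ m ih =>
      rcases lt_or_ge m d with hmd | hmd
      · have : |g m| ≤ C := Finset.single_le_sum (f := fun j => |g j|)
          (fun j _ => abs_nonneg _) (Finset.mem_range.mpr hmd)
        have : 0 ≤ c * d * m := by positivity
        linarith
      · obtain ⟨n, rfl⟩ := Nat.exists_eq_add_of_le' hmd
        have h1 := ih n (by omega)
        have h2 : |g (n + d) - g n| ≤ c * d * d := by
          have hl := mul_le_mul_of_nonneg_left (hlow n) hd'.le
          have hu := mul_le_mul_of_nonneg_left (hupp n) hd'.le
          rw [abs_le]
          simp only [hg, Nat.cast_add]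
          constructor <;> nlinarith
        have h3 := abs_add_le (g (n + d) - g n) (g n)
        rw [sub_add_cancel] at h3
        push_cast
        linarith
  have hinv : Tendsto (fun m : ℕ => ((m : ℝ))⁻¹) atTop (nhds 0) := tendsto_inv_atTop_nhds_zero_nat
  have hzero : Tendsto (fun m : ℕ => g m / (m : ℝ) ^ 2) atTop (nhds 0) := by
    refine squeeze_zero_norm (a := fun m : ℕ => C * ((m : ℝ)⁻¹ * (m : ℝ)⁻¹) + c * d * (m : ℝ)⁻¹)
      (fun m => ?_) ?_
    · rcases Nat.eq_zero_or_pos m with rfl | hm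
      · simp
      · have hm' : (0 : ℝ) < m := by exact_mod_cast hm
        rw [Real.norm_eq_abs, abs_div, abs_of_pos (pow_pos hm' 2), div_le_iff₀ (pow_pos hm' 2)]
        refine (hbound m).trans_eq ?_
        field_simp
    · simpa using ((hinv.mul hinv).const_mul C).add (hinv.const_mul (c * d))
  have hlim := (hzero.div_const (2 * (d : ℝ))).add_const (c / (2 * d))
  rw [zero_div, zero_add] at hlim
  refine hlim.congr' ?_
  filter_upwards [eventually_gt_atTop 0] with m hm
  have hm' : (0 : ℝ) < m := by exact_mod_cast hm
  simp only [hg]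
  field_simp
  ring

/-- The totient function as a divisor sum over the Möbius function. -/
lemma hasSum_moebius_totient {n : ℕ} (hn : 0 < n) :
    HasSum (fun d : ℕ => if d ∣ n then (μ d : ℝ) * (n / d) else 0) (Nat.totient n : ℝ) := by
  have h := (ArithmeticFunction.sum_eq_iff_sum_mul_moebius_eq (R := ℝ)
    (f := fun n => (Nat.totient n : ℝ)) (g := fun n => (n : ℝ))).mp
    (fun n _ => by exact_mod_cast Nat.sum_totient n) n hn
  rw [Nat.sum_divisorsAntidiagonal (f := fun x y => (μ x : ℝ) * (y : ℝ))] at h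
  have h2 : ∑ d ∈ n.divisors, (if d ∣ n then (μ d : ℝ) * (n / d) else 0) = Nat.totient n := by
    rw [← h]
    refine Finset.sum_congr rfl fun d hd => ?_
    have hdvd := Nat.dvd_of_mem_divisors hd
    have hd0 : (d : ℝ) ≠ 0 := by
      exact_mod_cast (Nat.pos_of_mem_divisors hd).ne'
    rw [if_pos hdvd, Nat.cast_div hdvd hd0]
  rw [← h2]
  refine hasSum_sum_of_ne_finset_zero fun d hd => if_neg fun hdvd => hd ?_
  exact Nat.mem_divisors.mpr ⟨hdvd, hn.ne'⟩

/-- The Möbius series at `2` with the multiples of the prime `p` removed. -/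
lemma tsum_moebius_div_sq_coprime {p : ℕ} (hp : p.Prime) :
    ∑' d : ℕ, (if p ∣ d then 0 else (μ d : ℝ) / (d : ℝ) ^ 2) =
      6 * (p : ℝ) ^ 2 / (((p : ℝ) ^ 2 - 1) * π ^ 2) := by
  have : NeZero p := ⟨hp.ne_zero⟩
  have hre : 1 < (2 : ℂ).re := by norm_num
  have hmul := DirichletCharacter.LSeries.mul_mu_eq_one (1 : DirichletCharacter ℂ p) hre
  have hL : LSeries (fun n : ℕ => (1 : DirichletCharacter ℂ p) n) 2 =
      (1 - ((p : ℂ) ^ 2)⁻¹) * ((π : ℂ) ^ 2 / 6) := by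
    rw [← DirichletCharacter.LFunction_eq_LSeries _ hre]
    have := DirichletCharacter.LFunctionTrivChar_eq_mul_riemannZeta (N := p) (s := 2) (by norm_num)
    rw [hp.primeFactors, Finset.prod_singleton, riemannZeta_two, Complex.cpow_neg] at this
    exact_mod_cast this
  have hsum : LSeries ((fun n : ℕ => (1 : DirichletCharacter ℂ p) n) * fun n : ℕ => (μ n : ℂ)) 2 =
      ((∑' d : ℕ, (if p ∣ d then 0 else (μ d : ℝ) / (d : ℝ) ^ 2) : ℝ) : ℂ) := by
    rw [LSeries, Complex.ofReal_tsum]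
    refine tsum_congr fun d => ?_
    rw [LSeries.term_of_ne_zero' two_ne_zero, Pi.mul_apply]
    by_cases hpd : p ∣ d
    · have : ¬ IsUnit (d : ZMod p) := by
        rw [ZMod.isUnit_iff_coprime, Nat.coprime_comm, hp.coprime_iff_not_dvd]
        exact not_not.mpr hpd
      simp [hpd, MulChar.map_nonunit _ this]
    · have : IsUnit (d : ZMod p) := by
        rwa [ZMod.isUnit_iff_coprime, Nat.coprime_comm, hp.coprime_iff_not_dvd]
      rw [if_neg hpd, MulChar.one_apply this]
      push_cast
      norm_num
  rw [hL, hsum] at hmul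
  have hreal : (1 - ((p : ℝ) ^ 2)⁻¹) * (π ^ 2 / 6) *
      ∑' d : ℕ, (if p ∣ d then 0 else (μ d : ℝ) / (d : ℝ) ^ 2) = 1 := by
    apply Complex.ofReal_injective
    push_cast at hmul ⊢
    exact hmul
  have hp1 : (1 : ℝ) < p := by exact_mod_cast hp.one_lt
  have hp2 : (p : ℝ) ^ 2 - 1 ≠ 0 := by nlinarith
  have hpi := Real.pi_ne_zero
  rw [eq_div_iff (by positivity)]
  field_simp at hreal
  linarith

/-- If `p` and `d` are coprime, every block of `d` consecutive integers contains exactly one `k`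
with `p * k ≡ i` modulo `d`. -/
lemma existsUnique_mul_modEq_mem_Ioc {p d : ℕ} (hd : 0 < d) (hpd : p.Coprime d) (i m : ℕ) :
    ∃ k, (Finset.Ioc m (m + d)).filter (fun k => p * k ≡ i [MOD d]) = {k} := by
  rw [← Finset.card_eq_one]
  obtain ⟨r, hr⟩ : ∃ r, p * r ≡ i [MOD d] := by
    have : NeZero d := ⟨hd.ne'⟩
    refine ⟨((p : ZMod d)⁻¹ * i).val, ?_⟩
    rw [← ZMod.natCast_eq_natCast_iff]
    push_cast
    rw [ZMod.natCast_zmod_val, ← mul_assoc, ZMod.coe_mul_inv_eq_one p hpd, one_mul]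
  have hiff : ∀ k, p * k ≡ i [MOD d] ↔ k ≡ r [MOD d] := fun k =>
    ⟨fun h => Nat.ModEq.cancel_left_of_coprime (by rwa [Nat.gcd_comm]) (h.trans hr.symm),
      fun h => (h.mul_left p).trans hr⟩
  simp_rw [hiff]
  have hIco : Finset.Ioc m (m + d) = Finset.Ico (m + 1) (m + 1 + d) := by
    ext; simp; omega
  rw [hIco, Nat.filter_Ico_card_eq_of_periodic, Nat.count_modEq_card _ hd]
  · simp [Nat.div_self hd]
  · intro k
    simp [Nat.ModEq]

/-- The sum of `(p * k - i) / d` over the `k ≤ m` for which it is an integer. -/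
noncomputable def divisibleQuotientSum (p i d m : ℕ) : ℝ :=
  ∑ k ∈ Finset.Icc 1 m, if d ∣ p * k - i then ((p * k - i : ℕ) : ℝ) / d else 0

lemma divisibleQuotientSum_nonneg (p i d m : ℕ) : 0 ≤ divisibleQuotientSum p i d m :=
  Finset.sum_nonneg fun k _ => by split_ifs <;> positivity

lemma lt_mul_of_one_le {p i k : ℕ} (hip : i < p) (hk : 1 ≤ k) : i < p * k :=
  hip.trans_le (Nat.le_mul_of_pos_right p hk)

lemma divisibleQuotientSum_le {p i : ℕ} (hip : i < p) (d m : ℕ) :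
    divisibleQuotientSum p i d m ≤ (((p : ℝ) * m) / d) ^ 2 := by
  rcases Nat.eq_zero_or_pos d with rfl | hd
  · simp [divisibleQuotientSum]
  have hd' : (0 : ℝ) < d := by exact_mod_cast hd
  set S := (Finset.Icc 1 m).filter (fun k => d ∣ p * k - i) with hS
  have hcard : S.card ≤ p * m / d := by
    have : S.card ≤ (Finset.Icc 1 (p * m / d)).card := by
      refine Finset.card_le_card_of_injOn (fun k => (p * k - i) / d) ?_ ?_
      · intro k hk
        simp only [hS, Finset.coe_filter, Finset.mem_Icc, Set.mem_ofPred_eq] at hk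
        have hlt := lt_mul_of_one_le hip hk.1.1
        simp only [Finset.coe_Icc, Set.mem_Icc]
        refine ⟨Nat.div_pos (Nat.le_of_dvd (by omega) hk.2) hd, Nat.div_le_div_right ?_⟩
        exact (Nat.sub_le _ _).trans (Nat.mul_le_mul_left p hk.1.2)
      · intro k hk l hl hkl
        simp only [hS, Finset.coe_filter, Finset.mem_Icc, Set.mem_ofPred_eq] at hk hl
        have h1 := (Nat.div_left_inj hk.2 hl.2).mp hkl
        have := lt_mul_of_one_le hip hk.1.1
        have := lt_mul_of_one_le hip hl.1.1
        exact Nat.eq_of_mul_eq_mul_left (by omega : 0 < p) (by omega)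
    simpa using this
  rw [divisibleQuotientSum, ← Finset.sum_filter, sq]
  have hterm : ∀ k ∈ S, ((p * k - i : ℕ) : ℝ) / d ≤ (p : ℝ) * m / d := by
    intro k hk
    simp only [hS, Finset.mem_filter, Finset.mem_Icc] at hk
    gcongr
    exact_mod_cast (Nat.sub_le _ _).trans (Nat.mul_le_mul_left p hk.1.2)
  refine (Finset.sum_le_card_nsmul S _ _ hterm).trans ?_
  rw [nsmul_eq_mul]
  gcongr
  have h1 : (S.card : ℝ) ≤ ((p * m / d : ℕ) : ℝ) := by exact_mod_cast hcard
  refine h1.trans (Nat.cast_div_le.trans_eq ?_)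
  push_cast
  rfl

lemma tendsto_divisibleQuotientSum {p i d : ℕ} (hip : i < p) (hd : 0 < d) (hpd : p.Coprime d) :
    Tendsto (fun m : ℕ => divisibleQuotientSum p i d m / ((p : ℝ) * m) ^ 2) atTop
      (nhds (1 / (2 * p * (d : ℝ) ^ 2))) := by
  have hd' : (0 : ℝ) < d := by exact_mod_cast hd
  have hp' : (0 : ℝ) < p := by exact_mod_cast (Nat.zero_le i).trans_lt hip
  have hstep : ∀ m : ℕ, ∃ k ∈ Finset.Ioc m (m + d),
      divisibleQuotientSum p i d (m + d) - divisibleQuotientSum p i d m =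
        ((p : ℝ) * k - i) / d := by
    intro m
    obtain ⟨k, hk⟩ := existsUnique_mul_modEq_mem_Ioc hd hpd i m
    have hkm : k ∈ Finset.Ioc m (m + d) :=
      Finset.filter_subset _ _ (hk ▸ Finset.mem_singleton_self k)
    refine ⟨k, hkm, ?_⟩
    have hunion : Finset.Icc 1 (m + d) = Finset.Icc 1 m ∪ Finset.Ioc m (m + d) := by
      ext; simp; omega
    have hdisj : Disjoint (Finset.Icc 1 m) (Finset.Ioc m (m + d)) := by
      rw [Finset.disjoint_left]; intro a; simp; omega
    have hfilter : (Finset.Ioc m (m + d)).filter (fun k => d ∣ p * k - i) = {k} := by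
      rw [← hk]
      refine Finset.filter_congr fun l hl => ?_
      have hl1 : 1 ≤ l := by simp at hl; omega
      rw [← Nat.modEq_iff_dvd' (lt_mul_of_one_le hip hl1).le]
      exact Nat.ModEq.comm
    have hk1 : 1 ≤ k := by simp at hkm; omega
    rw [divisibleQuotientSum, divisibleQuotientSum, hunion, Finset.sum_union hdisj,
      add_sub_cancel_left, ← Finset.sum_filter, hfilter, Finset.sum_singleton,
      Nat.cast_sub (lt_mul_of_one_le hip hk1).le, Nat.cast_mul]
  have hlim := tendsto_div_sq_of_step (f := divisibleQuotientSum p i d) (c := p / d) hd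
    (fun m => by
      obtain ⟨k, hk, h⟩ := hstep m
      rw [h, div_mul_eq_mul_div]
      gcongr
      have h1 : (m : ℝ) + 1 ≤ k := by exact_mod_cast (Finset.mem_Ioc.mp hk).1
      have h2 : (i : ℝ) ≤ p := by exact_mod_cast hip.le
      nlinarith)
    (fun m => by
      obtain ⟨k, hk, h⟩ := hstep m
      rw [h, div_mul_eq_mul_div]
      gcongr
      have h1 : (k : ℝ) ≤ m + d := by exact_mod_cast (Finset.mem_Ioc.mp hk).2
      have h2 : (0 : ℝ) ≤ i := by positivity
      nlinarith)
  convert hlim.div_const ((p : ℝ) ^ 2) using 1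
  · ext m
    rw [div_div, mul_pow, mul_comm]
  · congr 1
    field_simp

lemma divisibleQuotientSum_eq_zero {p i d : ℕ} (hi : 0 < i) (hip : i < p) (hpd : p ∣ d) (m : ℕ) :
    divisibleQuotientSum p i d m = 0 := by
  refine Finset.sum_eq_zero fun k hk => if_neg fun hdvd => ?_
  have hlt := lt_mul_of_one_le hip (Finset.mem_Icc.mp hk).1
  have : p ∣ i := (Nat.dvd_sub_iff_right hlt.le (dvd_mul_right p k)).mp (hpd.trans hdvd)
  exact absurd (Nat.le_of_dvd hi this) (by omega)

lemma hasSum_totient_residue_class {p i : ℕ} (hip : i < p) (m : ℕ) :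
    HasSum (fun d : ℕ => (μ d : ℝ) * divisibleQuotientSum p i d m)
      (∑ k ∈ Finset.Icc 1 m, (Nat.totient (p * k - i) : ℝ)) := by
  have h := hasSum_sum (s := Finset.Icc 1 m)
    (f := fun k d => if d ∣ p * k - i then (μ d : ℝ) * ((p * k - i : ℕ) / d) else 0)
    (a := fun k => (Nat.totient (p * k - i) : ℝ)) fun k hk =>
      hasSum_moebius_totient (Nat.sub_pos_of_lt (lt_mul_of_one_le hip (Finset.mem_Icc.mp hk).1))
  convert h using 2 with d
  rw [divisibleQuotientSum, Finset.mul_sum]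
  exact Finset.sum_congr rfl fun k _ => by rw [mul_ite, mul_zero]

theorem phi_sum_residue_class_limit (p : ℕ) (hp : p.Prime) (i : ℕ)
    (hi1 : 1 ≤ i) (hi2 : i ≤ p - 1) :
    Tendsto (fun m : ℕ =>
        (∑ k ∈ Finset.Icc 1 m, (Nat.totient (p * k - i) : ℝ)) / ((p : ℝ) * m) ^ 2)
      atTop (nhds (3 * (p : ℝ) / (((p : ℝ) ^ 2 - 1) * π ^ 2))) := by
  have hip : i < p := by have := hp.pos; omega
  have hp' : (0 : ℝ) < p := by exact_mod_cast hp.pos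
  have hlimit : ∑' d : ℕ, (if p ∣ d then 0 else (μ d : ℝ) / (d : ℝ) ^ 2) * (1 / (2 * p)) =
      3 * (p : ℝ) / (((p : ℝ) ^ 2 - 1) * π ^ 2) := by
    rw [tsum_mul_right, tsum_moebius_div_sq_coprime hp, div_mul_div_comm, mul_one,
      show 6 * (p : ℝ) ^ 2 = 3 * p * (2 * p) by ring, mul_div_mul_right _ _ (by positivity)]
  have hseries : ∀ m : ℕ, (∑ k ∈ Finset.Icc 1 m, (Nat.totient (p * k - i) : ℝ)) /
      ((p : ℝ) * m) ^ 2 =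
      ∑' d : ℕ, (μ d : ℝ) * (divisibleQuotientSum p i d m / ((p : ℝ) * m) ^ 2) := fun m => by
    simp_rw [← mul_div_assoc]
    exact ((hasSum_totient_residue_class hip m).div_const _).tsum_eq.symm
  simp_rw [hseries]
  rw [← hlimit]
  refine tendsto_tsum_of_dominated_convergence (bound := fun d : ℕ => 1 / (d : ℝ) ^ 2)
    (Real.summable_one_div_nat_pow.mpr one_lt_two) (fun d => ?_) (Eventually.of_forall ?_)
  · split_ifs with hpd
    · simp [divisibleQuotientSum_eq_zero hi1 hip hpd]
    · have hd : 0 < d := Nat.pos_of_ne_zero fun h => hpd (h ▸ dvd_zero p)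
      convert (tendsto_divisibleQuotientSum hip hd
        ((hp.coprime_iff_not_dvd).mpr hpd)).const_mul (μ d : ℝ) using 2
      field_simp
  · intro m d
    have hmu : |(μ d : ℝ)| ≤ 1 := by exact_mod_cast ArithmeticFunction.abs_moebius_le_one (n := d)
    have hnonneg := divisibleQuotientSum_nonneg p i d m
    rw [norm_mul, Real.norm_eq_abs, Real.norm_eq_abs,
      abs_of_nonneg (div_nonneg hnonneg (sq_nonneg _)), ← one_mul (1 / (d : ℝ) ^ 2)]
    refine mul_le_mul hmu ?_ (by positivity) zero_le_one
    refine div_le_of_le_mul₀ (by positivity) (by positivity) ?_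
    refine (divisibleQuotientSum_le hip d m).trans_eq ?_
    rw [div_pow, one_div, inv_mul_eq_div]
end

section
/- Let p be an odd prime and let j be an integer with 1 ≤ j ≤ p−1. Then the limit as n → ∞ of (∑_{k=1}^n φ(2p·k − 2j)) / (2p·n)² equals p / ((p² − 1)·π²). -/
open Filter Finset Real

open scoped ArithmeticFunction.Moebius

lemma totient_eq_mul_sum_divisors_moebius_div {n : ℕ} (hn : n ≠ 0) :
    (n.totient : ℝ) = n * ∑ d ∈ n.divisors, (μ d : ℝ) / d := by
  have h := (ArithmeticFunction.sum_eq_iff_sum_mul_moebius_eq (R := ℝ)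
    (f := fun n ↦ (n.totient : ℝ)) (g := fun n ↦ (n : ℝ))).1
    (fun n _ ↦ by exact_mod_cast Nat.sum_totient n) n (Nat.pos_of_ne_zero hn)
  rw [← h, Nat.sum_divisorsAntidiagonal (fun a b ↦ (μ a : ℝ) * (b : ℝ)), mul_sum]
  refine sum_congr rfl fun d hd ↦ ?_
  have hdvd := Nat.dvd_of_mem_divisors hd
  have hd0 : (d : ℝ) ≠ 0 := by exact_mod_cast (Nat.pos_of_mem_divisors hd).ne'
  rw [Nat.cast_div hdvd hd0]
  ring

lemma totient_two_mul_eq_mul_sum {p m : ℕ} (hm : m ≠ 0) (hpm : m.Coprime p) :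
    ((2 * m).totient : ℝ) =
      m * ∑ d ∈ m.divisors, if d.Coprime (2 * p) then (μ d : ℝ) / d else 0 := by
  obtain ⟨a, t, ht, rfl⟩ := Nat.exists_eq_two_pow_mul_odd hm
  have ht0 : t ≠ 0 := by rintro rfl; simp at ht
  have htp : t.Coprime (2 * p) :=
    Nat.Coprime.mul_right (Nat.coprime_two_right.2 ht) (hpm.coprime_mul_left)
  have hfilter : {d ∈ (2 ^ a * t).divisors | d.Coprime (2 * p)} = t.divisors := by
    ext d
    simp only [mem_filter, Nat.mem_divisors]
    constructor
    · rintro ⟨⟨h, -⟩, hd⟩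
      exact ⟨(Nat.Coprime.pow_right a hd.coprime_mul_right_right).dvd_of_dvd_mul_left h, ht0⟩
    · rintro ⟨h, -⟩
      exact ⟨⟨h.mul_left _, hm⟩, htp.coprime_dvd_left h⟩
  rw [← sum_filter, hfilter, ← mul_assoc, ← pow_succ',
    Nat.totient_mul ((Nat.coprime_two_left.2 ht).pow_left _),
    Nat.totient_prime_pow_succ Nat.prime_two]
  push_cast
  rw [totient_eq_mul_sum_divisors_moebius_div ht0]
  norm_num
  ring

/-- Summation by parts with linear weights, for a sequence with bounded discrepancy. -/
lemma tendsto_sum_linear_mul_div_sq {g : ℕ → ℝ} {L C : ℝ} (a b : ℝ)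
    (hg : ∀ n : ℕ, |∑ i ∈ range n, g i - L * n| ≤ C) :
    Tendsto (fun n : ℕ ↦ (∑ i ∈ range n, (a * i + b) * g i) / (n : ℝ) ^ 2) atTop
      (nhds (a * L / 2)) := by
  set H : ℕ → ℝ := fun n ↦ ∑ i ∈ range n, g i - L * n with hH
  have hparts (n : ℕ) : ∑ i ∈ range n, (a * i + b) * g i =
      a * L * (n * (n - 1) / 2) + b * L * n + (a * n + b) * H n -
        a * ∑ i ∈ range n, H (i + 1) := by
    induction n with
    | zero => simp [hH]
    | succ n ih =>
      have hs : H (n + 1) = H n + g n - L := by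
        simp only [hH, sum_range_succ]; push_cast; ring
      rw [sum_range_succ, ih, sum_range_succ, hs]
      push_cast; ring
  have hlim : Tendsto (fun n : ℕ ↦ (|a * L / 2| + |b * L| + (|a| + |b|) * C + |a| * C) / (n : ℝ))
      atTop (nhds 0) := tendsto_const_div_atTop_nhds_zero_nat _
  rw [tendsto_iff_norm_sub_tendsto_zero]
  refine squeeze_zero' (Eventually.of_forall fun _ ↦ norm_nonneg _) ?_ hlim
  filter_upwards [eventually_ge_atTop 1] with n hn
  have hn1 : (1 : ℝ) ≤ n := by exact_mod_cast hn
  have hn0 : (0 : ℝ) < n := by linarith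
  have hS : |∑ i ∈ range n, H (i + 1)| ≤ n * C :=
    (abs_sum_le_sum_abs _ _).trans <|
      (sum_le_sum fun i _ ↦ hg (i + 1)).trans_eq (by simp)
  have hC : 0 ≤ C := (abs_nonneg _).trans (hg 0)
  have heq : (∑ i ∈ range n, (a * i + b) * g i) / (n : ℝ) ^ 2 - a * L / 2 =
      (-(a * L / 2) * n + b * L * n + (a * n + b) * H n - a * ∑ i ∈ range n, H (i + 1)) /
        (n : ℝ) ^ 2 := by
    rw [hparts]; field_simp; ring
  rw [heq, Real.norm_eq_abs, abs_div, abs_of_pos (by positivity : (0 : ℝ) < (n : ℝ) ^ 2),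
    div_le_div_iff₀ (by positivity) hn0]
  have h1 : |-(a * L / 2) * n + b * L * n + (a * n + b) * H n - a * ∑ i ∈ range n, H (i + 1)| ≤
      |a * L / 2| * n + |b * L| * n + (|a| * n + |b| * n) * C + |a| * (n * C) := by
    refine (abs_sub _ _).trans (add_le_add ((abs_add_le _ _).trans
      (add_le_add ((abs_add_le _ _).trans (add_le_add ?_ ?_)) ?_)) ?_)
    · rw [abs_mul, abs_neg, abs_of_pos hn0]
    · rw [abs_mul, abs_of_pos hn0]
    · rw [abs_mul]
      refine mul_le_mul ((abs_add_le _ _).trans ?_) (hg n) (abs_nonneg _) (by positivity)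
      rw [abs_mul, abs_of_pos hn0]
      gcongr
      exact le_mul_of_one_le_right (abs_nonneg _) hn1
    · rw [abs_mul]
      gcongr
  calc _ ≤ (|a * L / 2| * n + |b * L| * n + (|a| * n + |b| * n) * C + |a| * (n * C)) * n := by
        gcongr
    _ = _ := by ring

lemma abs_sum_indicator_dvd_linear_sub_le {p d : ℕ} (hd : d ≠ 0) (hpd : d.Coprime p) (c n : ℕ) :
    |∑ i ∈ range n, (if d ∣ p * i + c then (1 : ℝ) else 0) - (d : ℝ)⁻¹ * n| ≤ 1 := by
  have hd' : 0 < d := Nat.pos_of_ne_zero hd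
  obtain ⟨r, hr⟩ : ∃ r, d ∣ p * r + c := by
    have : NeZero d := ⟨hd⟩
    refine ⟨((-c : ZMod d) * (p : ZMod d)⁻¹).val, ?_⟩
    rw [← ZMod.natCast_eq_zero_iff]
    push_cast
    rw [ZMod.natCast_zmod_val, mul_comm, mul_assoc, mul_comm _ (p : ZMod d),
      ZMod.coe_mul_inv_eq_one p hpd.symm]
    ring
  have hiff (i : ℕ) : d ∣ p * i + c ↔ i ≡ r [MOD d] := by
    rw [← Nat.modEq_zero_iff_dvd]
    have hr' := (Nat.modEq_zero_iff_dvd.2 hr)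
    constructor
    · intro h
      exact Nat.ModEq.cancel_left_of_coprime hpd
        (Nat.ModEq.add_right_cancel' c (h.trans hr'.symm))
    · intro h
      exact ((h.mul_left p).add_right c).trans hr'
  simp only [hiff]
  rw [sum_boole, ← Nat.count_eq_card_filter_range, Nat.count_modEq_card n hd' r]
  have h1 : (n : ℝ) = d * (n / d : ℕ) + (n % d : ℕ) := by exact_mod_cast (Nat.div_add_mod n d).symm
  have hdR : (0 : ℝ) < d := by exact_mod_cast hd'
  have h2 : (d : ℝ)⁻¹ * n = (n / d : ℕ) + (d : ℝ)⁻¹ * (n % d : ℕ) := by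
    conv_lhs => rw [h1]
    field_simp
  have h3 : (d : ℝ)⁻¹ * (n % d : ℕ) ≤ 1 := by
    rw [inv_mul_le_iff₀ hdR, mul_one]; exact_mod_cast (Nat.mod_lt n hd').le
  have h4 : 0 ≤ (d : ℝ)⁻¹ * (n % d : ℕ) := by positivity
  rw [h2, abs_le]
  push_cast
  split_ifs <;> constructor <;> linarith

lemma sum_indicator_dvd_linear_le {p d c : ℕ} (hp : p ≠ 0) (hc : 0 < c) (hcp : c ≤ p) (n : ℕ) :
    ∑ i ∈ range n, (if d ∣ p * i + c then (1 : ℝ) else 0) ≤ p * n / d := by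
  rw [sum_boole]
  have hcard : #{i ∈ range n | d ∣ p * i + c} ≤ #{x ∈ Ioc 0 (p * n) | d ∣ x} := by
    refine card_le_card_of_injOn (fun i ↦ p * i + c) ?_ ?_
    · intro i hi
      simp only [coe_filter, Set.mem_ofPred_eq, mem_range, mem_Ioc] at hi ⊢
      refine ⟨⟨by positivity, ?_⟩, hi.2⟩
      calc p * i + c ≤ p * (i + 1) := by rw [mul_add]; omega
        _ ≤ p * n := Nat.mul_le_mul_left p hi.1
    · intro x _ y _ h
      exact Nat.eq_of_mul_eq_mul_left (Nat.pos_of_ne_zero hp) (Nat.add_right_cancel h)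
  rw [Nat.Ioc_filter_dvd_card_eq_div] at hcard
  calc _ ≤ ((p * n / d : ℕ) : ℝ) := by exact_mod_cast hcard
    _ ≤ _ := by exact_mod_cast Nat.cast_div_le (α := ℝ)

lemma tsum_coprime_moebius_div_sq {N : ℕ} [NeZero N] :
    ∑' d : ℕ, (if d.Coprime N then (μ d : ℝ) / d else 0) * (d : ℝ)⁻¹ =
      (6 / π ^ 2) * (∏ q ∈ N.primeFactors, (1 - (q : ℝ)⁻¹ ^ 2))⁻¹ := by
  have h2 : 1 < (2 : ℂ).re := by norm_num
  have h := DirichletCharacter.LSeries.mul_mu_eq_one (1 : DirichletCharacter ℂ N) h2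
  rw [← DirichletCharacter.LFunction_eq_LSeries _ h2,
    show DirichletCharacter.LFunction (1 : DirichletCharacter ℂ N) 2 = _ from
      DirichletCharacter.LFunctionTrivChar_eq_mul_riemannZeta (by norm_num), riemannZeta_two] at h
  have hL : LSeries ((fun n : ℕ ↦ (1 : DirichletCharacter ℂ N) n) * fun n : ℕ ↦ (μ n : ℂ)) 2 =
      ((∑' d : ℕ, (if d.Coprime N then (μ d : ℝ) / d else 0) * (d : ℝ)⁻¹ : ℝ) : ℂ) := by
    rw [LSeries, Complex.ofReal_tsum]
    refine tsum_congr fun d ↦ ?_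
    rw [LSeries.term_of_ne_zero' two_ne_zero]
    by_cases hd : d.Coprime N
    · have : (1 : DirichletCharacter ℂ N) d = 1 :=
        MulChar.one_apply ((ZMod.isUnit_iff_coprime d N).2 hd)
      rw [if_pos hd]
      simp [this]
      ring
    · have : (1 : DirichletCharacter ℂ N) d = 0 :=
        MulChar.map_nonunit _ (fun h ↦ hd ((ZMod.isUnit_iff_coprime d N).1 h))
      rw [if_neg hd]
      simp [this]
  rw [hL] at h
  have hprod : ∏ q ∈ N.primeFactors, (1 - (q : ℂ) ^ (-2 : ℂ)) =
      ((∏ q ∈ N.primeFactors, (1 - (q : ℝ)⁻¹ ^ 2) : ℝ) : ℂ) := by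
    push_cast
    refine prod_congr rfl fun q _ ↦ ?_
    rw [Complex.cpow_neg, Complex.cpow_ofNat, inv_pow]
  rw [hprod] at h
  have hR : (∏ q ∈ N.primeFactors, (1 - (q : ℝ)⁻¹ ^ 2)) * (π ^ 2 / 6) *
      (∑' d : ℕ, (if d.Coprime N then (μ d : ℝ) / d else 0) * (d : ℝ)⁻¹) = 1 := by
    exact_mod_cast h
  have hP : (∏ q ∈ N.primeFactors, (1 - (q : ℝ)⁻¹ ^ 2)) ≠ 0 := by
    intro h0; rw [h0, zero_mul, zero_mul] at hR; exact zero_ne_one hR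
  have := pi_pos.ne'
  rw [← div_eq_mul_inv, eq_div_iff hP, eq_div_iff (by positivity)]
  linear_combination 6 * hR

lemma abs_coprime_moebius_div_le (N d : ℕ) :
    |if d.Coprime N then (μ d : ℝ) / d else 0| ≤ (d : ℝ)⁻¹ := by
  split_ifs
  · rw [abs_div, Nat.abs_cast, div_eq_mul_inv]
    refine mul_le_of_le_one_left (by positivity) ?_
    exact_mod_cast ArithmeticFunction.abs_moebius_le_one (n := d)
  · simp

lemma sum_totient_two_mul_linear_eq_tsum {p c : ℕ} (hc : 0 < c) (hcp : c.Coprime p) (n : ℕ) :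
    ∑ i ∈ range n, ((2 * (p * i + c)).totient : ℝ) =
      ∑' d : ℕ, (if d.Coprime (2 * p) then (μ d : ℝ) / d else 0) *
        ∑ i ∈ range n, ((p : ℝ) * i + c) * if d ∣ p * i + c then (1 : ℝ) else 0 := by
  have hterm (i : ℕ) : HasSum (fun d : ℕ ↦ (if d.Coprime (2 * p) then (μ d : ℝ) / d else 0) *
      (((p : ℝ) * i + c) * if d ∣ p * i + c then (1 : ℝ) else 0))
      ((2 * (p * i + c)).totient : ℝ) := by
    have hm : p * i + c ≠ 0 := by omega
    rw [totient_two_mul_eq_mul_sum hm (p := p) (by simpa using hcp), mul_sum]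
    convert hasSum_sum_of_ne_finset_zero (s := (p * i + c).divisors) ?_ using 1
    · refine sum_congr rfl fun d hd ↦ ?_
      rw [if_pos (Nat.dvd_of_mem_divisors hd)]
      push_cast
      ring
    · intro d hd
      have : ¬ d ∣ p * i + c := fun h ↦ hd (Nat.mem_divisors.2 ⟨h, hm⟩)
      simp [this]
    · infer_instance
  rw [← (hasSum_sum fun i _ ↦ hterm i).tsum_eq]
  simp only [mul_sum]

lemma tendsto_sum_totient_two_mul_linear {p c : ℕ} (hp : p ≠ 0) (hc : 0 < c) (hcp : c ≤ p)
    (hcop : c.Coprime p) :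
    Tendsto (fun n : ℕ ↦ (∑ i ∈ range n, ((2 * (p * i + c)).totient : ℝ)) / (n : ℝ) ^ 2) atTop
      (nhds (p / 2 * ∑' d : ℕ, (if d.Coprime (2 * p) then (μ d : ℝ) / d else 0) *
        (d : ℝ)⁻¹)) := by
  simp only [sum_totient_two_mul_linear_eq_tsum hc hcop]
  simp only [← tsum_div_const, ← tsum_mul_left, mul_div_assoc]
  refine tendsto_tsum_of_dominated_convergence (bound := fun d : ℕ ↦ (p : ℝ) ^ 2 * ((d : ℝ) ^ 2)⁻¹)
    ((Real.summable_nat_pow_inv.2 one_lt_two).mul_left _) (fun d ↦ ?_) ?_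
  · by_cases hd : d.Coprime (2 * p)
    · have hd0 : d ≠ 0 := by
        rintro rfl
        simp at hd
      have := (tendsto_sum_linear_mul_div_sq (p : ℝ) (c : ℝ) (fun n ↦
        abs_sum_indicator_dvd_linear_sub_le hd0 hd.coprime_mul_left_right c n)).const_mul
        ((μ d : ℝ) / d)
      simp only [if_pos hd]
      convert this using 2
      ring
    · simp [hd]
  · filter_upwards [eventually_ge_atTop 1] with n hn d
    have hn0 : (0 : ℝ) < n := by exact_mod_cast hn
    have hsum : ∑ i ∈ range n, ((p : ℝ) * i + c) * (if d ∣ p * i + c then (1 : ℝ) else 0) ≤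
        (p * n) * (p * n / d) := by
      refine le_trans ?_ (mul_le_mul_of_nonneg_left
        (sum_indicator_dvd_linear_le hp hc hcp n) (by positivity))
      rw [mul_sum]
      refine sum_le_sum fun i hi ↦ mul_le_mul_of_nonneg_right ?_ (by positivity)
      have hi' : (i : ℝ) + 1 ≤ n := by exact_mod_cast mem_range.1 hi
      have hc' : (c : ℝ) ≤ p := by exact_mod_cast hcp
      nlinarith [mul_le_mul_of_nonneg_left hi' (Nat.cast_nonneg (α := ℝ) p)]
    rw [norm_mul, Real.norm_eq_abs, Real.norm_eq_abs, abs_div,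
      abs_of_nonneg (by positivity : 0 ≤ ∑ i ∈ range n, ((p : ℝ) * i + c) *
        (if d ∣ p * i + c then (1 : ℝ) else 0)), abs_of_pos (by positivity : (0 : ℝ) < (n : ℝ) ^ 2)]
    calc _ ≤ (d : ℝ)⁻¹ * ((p * n) * (p * n / d) / (n : ℝ) ^ 2) := by
          gcongr
          exact abs_coprime_moebius_div_le _ _
      _ = _ := by field_simp

theorem phi_sum_even_residue_class_mod_2p_limit (p : ℕ) (hp : p.Prime) (hodd : Odd p)
    (j : ℕ) (hj1 : 1 ≤ j) (hj2 : j ≤ p - 1) :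
    Tendsto (fun n : ℕ =>
        (∑ k ∈ Finset.Icc 1 n, (Nat.totient (2 * p * k - 2 * j) : ℝ)) /
          (2 * (p : ℝ) * n) ^ 2)
      atTop (nhds ((p : ℝ) / (((p : ℝ) ^ 2 - 1) * π ^ 2))) := by
  have hp2 := hp.two_le
  have hcop : (p - j).Coprime p :=
    Nat.Coprime.symm ((Nat.Prime.coprime_iff_not_dvd hp).2
      (Nat.not_dvd_of_pos_of_lt (by omega) (by omega)))
  have hlim := (tendsto_sum_totient_two_mul_linear hp.ne_zero (by omega) (Nat.sub_le p j)
    hcop).div_const ((2 * (p : ℝ)) ^ 2)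
  have : NeZero (2 * p) := ⟨by omega⟩
  rw [tsum_coprime_moebius_div_sq, Nat.primeFactors_mul two_ne_zero hp.ne_zero,
    Nat.prime_two.primeFactors, hp.primeFactors,
    prod_union (disjoint_singleton.2 (by rintro rfl; exact absurd hodd (by decide))), prod_singleton,
    prod_singleton] at hlim
  have hsum (n : ℕ) : ∑ k ∈ Icc 1 n, (Nat.totient (2 * p * k - 2 * j) : ℝ) =
      ∑ i ∈ range n, ((2 * (p * i + (p - j))).totient : ℝ) := by
    rw [range_eq_Ico, ← Finset.Ico_add_one_right_eq_Icc, sum_Ico_eq_sum_range, range_eq_Ico]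
    refine sum_congr (by simp) fun i _ ↦ ?_
    congr 2
    have : 2 * p * (1 + i) = 2 * (p * i) + 2 * p := by ring
    omega
  simp only [hsum]
  have hpR : (2 : ℝ) ≤ p := by exact_mod_cast hp2
  have hp1 : (p : ℝ) ^ 2 - 1 ≠ 0 := by nlinarith
  have hpi := pi_pos.ne'
  convert hlim using 2
  · rw [div_div]
    ring
  · have h1 : 1 - (p : ℝ)⁻¹ ^ 2 = (p ^ 2 - 1) / p ^ 2 := by field_simp
    rw [h1]
    push_cast
    field_simp
    norm_num
end

section
/- Let p be an odd prime. Then the limit as n → ∞ of (∑_{k=1}^n φ(2p·k)) / (2p·n)² equals 1 / ((p+1)·π²). -/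
open Filter Finset Real

open scoped ArithmeticFunction.Moebius

/-- The Möbius function restricted to the integers coprime to `m`. -/
noncomputable def coprimeMoebius (m : ℕ) : ArithmeticFunction ℝ where
  toFun d := if d.Coprime m then (μ d : ℝ) else 0
  map_zero' := by simp

/-- The normalised function `k ↦ φ (m * k) / φ m`. -/
noncomputable def totientRatio (m : ℕ) : ArithmeticFunction ℝ where
  toFun k := (Nat.totient (m * k) : ℝ) / Nat.totient m
  map_zero' := by simp

theorem coprimeMoebius_apply (m d : ℕ) :
    coprimeMoebius m d = if d.Coprime m then (μ d : ℝ) else 0 := rfl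

theorem totientRatio_apply (m k : ℕ) :
    totientRatio m k = (Nat.totient (m * k) : ℝ) / Nat.totient m := rfl

theorem isMultiplicative_coprimeMoebius (m : ℕ) : (coprimeMoebius m).IsMultiplicative := by
  refine ⟨by simp [coprimeMoebius_apply], fun {a b} hab => ?_⟩
  simp only [coprimeMoebius_apply, Nat.coprime_mul_iff_left,
    ArithmeticFunction.isMultiplicative_moebius.map_mul_of_coprime hab, Int.cast_mul]
  grind

theorem abs_coprimeMoebius_le_one (m d : ℕ) : |coprimeMoebius m d| ≤ 1 := by
  rw [coprimeMoebius_apply]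
  split_ifs
  · exact_mod_cast ArithmeticFunction.abs_moebius_le_one
  · simp

theorem Nat.totient_mul_mul_totient {m a b : ℕ} (hm : 0 < m) (hab : a.Coprime b) :
    Nat.totient (m * (a * b)) * Nat.totient m = Nat.totient (m * a) * Nat.totient (m * b) := by
  have h₁ := Nat.totient_gcd_mul_totient_mul (m * a) (m * b)
  have h₂ := Nat.totient_gcd_mul_totient_mul m (m * (a * b))
  rw [Nat.gcd_mul_left, hab.gcd_eq_one, mul_one] at h₁
  rw [Nat.gcd_eq_left (dvd_mul_right m _)] at h₂
  rw [show m * a * (m * b) = m * (m * (a * b)) by ring, h₂] at h₁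
  refine Nat.eq_of_mul_eq_mul_right hm ?_
  linarith

theorem isMultiplicative_totientRatio {m : ℕ} (hm : 0 < m) :
    (totientRatio m).IsMultiplicative := by
  have hφ : (Nat.totient m : ℝ) ≠ 0 := by exact_mod_cast (Nat.totient_pos.2 hm).ne'
  refine ⟨by simp [totientRatio_apply, hφ], fun {a b} hab => ?_⟩
  have h : (Nat.totient (m * (a * b)) : ℝ) * Nat.totient m =
      Nat.totient (m * a) * Nat.totient (m * b) := by
    exact_mod_cast Nat.totient_mul_mul_totient hm hab
  simp only [totientRatio_apply]
  field_simp
  linarith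

theorem totient_mul_prime_pow_of_dvd {m q : ℕ} (hq : q.Prime) (h : q ∣ m) (i : ℕ) :
    Nat.totient (m * q ^ i) = Nat.totient m * q ^ i := by
  induction i with
  | zero => simp
  | succ i ih =>
    rw [show m * q ^ (i + 1) = q * (m * q ^ i) by ring,
      Nat.totient_mul_of_prime_of_dvd hq (h.mul_right _), ih]
    ring

theorem totientRatio_eq_mul {m : ℕ} (hm : 0 < m) :
    totientRatio m = coprimeMoebius m *
      ((ArithmeticFunction.id : ArithmeticFunction ℕ) : ArithmeticFunction ℝ) := by
  have hφ : (Nat.totient m : ℝ) ≠ 0 := by exact_mod_cast (Nat.totient_pos.2 hm).ne'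
  rw [ArithmeticFunction.IsMultiplicative.eq_iff_eq_on_prime_powers _
    (isMultiplicative_totientRatio hm) _
    ((isMultiplicative_coprimeMoebius m).mul ArithmeticFunction.isMultiplicative_id.natCast)]
  intro q i hq
  rw [ArithmeticFunction.mul_apply, Nat.sum_divisorsAntidiagonal
    (fun a b => coprimeMoebius m a *
      ((ArithmeticFunction.id : ArithmeticFunction ℕ) : ArithmeticFunction ℝ) b),
    Nat.sum_divisors_prime_pow hq]
  simp only [ArithmeticFunction.natCoe_apply, ArithmeticFunction.id_apply, totientRatio_apply]
  cases i with
  | zero => simp [coprimeMoebius_apply, hφ]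
  | succ i =>
    rw [sum_range_succ', sum_range_succ']
    have hzero : ∀ j, coprimeMoebius m (q ^ (j + 1 + 1)) = 0 := fun j => by
      have : μ (q ^ (j + 1 + 1)) = 0 := by
        rw [ArithmeticFunction.moebius_apply_prime_pow hq (by simp)]; simp
      simp [coprimeMoebius_apply, this]
    simp only [hzero, zero_mul, sum_const_zero, zero_add, pow_one, pow_zero]
    rw [pow_succ, Nat.mul_div_cancel _ hq.pos, ← pow_succ]
    by_cases h : q ∣ m
    · have hc : ¬ q.Coprime m := fun h' => (hq.coprime_iff_not_dvd.1 h') h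
      rw [totient_mul_prime_pow_of_dvd hq h]
      simp [coprimeMoebius_apply, hc]
      field_simp
    · have hc : q.Coprime m := hq.coprime_iff_not_dvd.2 h
      rw [Nat.totient_mul (hc.symm.pow_right _), Nat.totient_prime_pow_succ hq]
      rw [coprimeMoebius_apply, if_pos hc]
      simp [coprimeMoebius_apply, ArithmeticFunction.moebius_apply_prime hq,
        Nat.cast_sub hq.one_le]
      field_simp
      ring

theorem sum_Ioc_natCast (n : ℕ) : ∑ k ∈ Ioc 0 n, (k : ℝ) = (n : ℝ) * (n + 1) / 2 := by
  induction n with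
  | zero => simp
  | succ n ih => rw [Finset.sum_Ioc_succ_top (Nat.zero_le n), ih]; push_cast; ring

theorem tendsto_natDiv_div (d : ℕ) :
    Tendsto (fun n : ℕ => ((n / d : ℕ) : ℝ) / n) atTop (nhds (1 / (d : ℝ))) := by
  have h := (tendsto_nat_floor_mul_div_atTop (R := ℝ) (a := 1 / (d : ℝ)) (by positivity)).comp
    tendsto_natCast_atTop_atTop
  refine h.congr fun n => ?_
  simp only [Function.comp_apply]
  rw [one_div_mul_eq_div, Nat.floor_div_eq_div]

/-- If `f` is the Dirichlet convolution of a bounded function `h` with the identity, then the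
partial sums of `f` are asymptotic to `n ^ 2 / 2 * ∑ h d / d ^ 2`. -/
theorem tendsto_sum_mul_id_div_sq (h : ArithmeticFunction ℝ) (hb : ∀ d, |h d| ≤ 1) :
    Tendsto (fun n : ℕ => (∑ k ∈ Ioc 0 n, (h *
      ((ArithmeticFunction.id : ArithmeticFunction ℕ) : ArithmeticFunction ℝ)) k) / (n : ℝ) ^ 2)
      atTop (nhds (∑' d : ℕ, h d / (2 * (d : ℝ) ^ 2))) := by
  have key : ∀ n : ℕ, (∑ k ∈ Ioc 0 n, (h *
      ((ArithmeticFunction.id : ArithmeticFunction ℕ) : ArithmeticFunction ℝ)) k) / (n : ℝ) ^ 2 =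
      ∑' d : ℕ, h d * (((n / d : ℕ) : ℝ) / n * (((n / d : ℕ) : ℝ) / n + 1 / n) / 2) := fun n => by
    rw [ArithmeticFunction.sum_Ioc_mul_eq_sum_sum, tsum_eq_sum (s := Ioc 0 n), sum_div]
    · refine sum_congr rfl fun d _ => ?_
      simp only [ArithmeticFunction.natCoe_apply, ArithmeticFunction.id_apply, sum_Ioc_natCast]
      ring
    · intro d hd
      have : n / d = 0 := by
        rcases Nat.eq_zero_or_pos d with rfl | hd0
        · simp
        · exact Nat.div_eq_of_lt (by simp at hd; omega)
      simp [this]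
  simp only [key]
  refine tendsto_tsum_of_dominated_convergence (bound := fun d : ℕ => 1 / (d : ℝ) ^ 2)
    (Real.summable_one_div_nat_pow.2 one_lt_two) (fun d => ?_) (Eventually.of_forall fun n d => ?_)
  · have h₁ := tendsto_natDiv_div d
    have h₂ := ((h₁.mul (h₁.add tendsto_one_div_atTop_nhds_zero_nat)).div_const 2).const_mul (h d)
    convert h₂ using 2
    ring
  · rw [norm_mul, Real.norm_eq_abs, Real.norm_eq_abs]
    refine (mul_le_of_le_one_left (abs_nonneg _) (hb d)).trans ?_
    rw [abs_of_nonneg (by positivity)]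
    rcases Nat.eq_zero_or_pos (n / d) with h0 | h0
    · simp [h0]
    · have hd : 0 < d := Nat.pos_of_ne_zero fun h => by simp [h] at h0
      have hn : 0 < n := Nat.pos_of_ne_zero fun h => by simp [h] at h0
      have hn' : (0 : ℝ) < n := by exact_mod_cast hn
      have hle : ((n / d : ℕ) : ℝ) / n ≤ 1 / d := by
        rw [div_le_iff₀ hn', one_div_mul_eq_div]
        exact Nat.cast_div_le
      have h1 : 1 / (n : ℝ) ≤ ((n / d : ℕ) : ℝ) / n := by
        gcongr
        exact_mod_cast h0
      have h2 : (0 : ℝ) ≤ ((n / d : ℕ) : ℝ) / n := by positivity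
      have h3 : 1 / (d : ℝ) ^ 2 = (1 / d) ^ 2 := by ring
      rw [h3]
      nlinarith

theorem tsum_coprimeMoebius_div_sq (m : ℕ) [NeZero m] :
    ∑' d : ℕ, coprimeMoebius m d / (d : ℝ) ^ 2 =
      ((∏ q ∈ m.primeFactors, (1 - ((q : ℝ) ^ 2)⁻¹)) * (π ^ 2 / 6))⁻¹ := by
  have hs : 1 < (2 : ℂ).re := by simp
  have hL := DirichletCharacter.LSeries.mul_mu_eq_one (1 : DirichletCharacter ℂ m) hs
  have hF := DirichletCharacter.LFunctionTrivChar_eq_mul_riemannZeta (N := m) (s := 2) (by simp)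
  rw [DirichletCharacter.LFunctionTrivChar, DirichletCharacter.LFunction_eq_LSeries _ hs,
    riemannZeta_two] at hF
  rw [hF] at hL
  have hR := eq_inv_of_mul_eq_one_right hL
  rw [LSeries] at hR
  apply Complex.ofReal_injective
  rw [Complex.ofReal_tsum]
  have hcp : ∀ x : ℂ, x ^ (-2 : ℂ) = (x ^ 2)⁻¹ := fun x => by
    rw [Complex.cpow_neg, Complex.cpow_ofNat]
  simp only [hcp] at hR
  push_cast
  rw [← hR]
  refine tsum_congr fun d => ?_
  rcases eq_or_ne d 0 with rfl | hd
  · simp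
  rw [LSeries.term_of_ne_zero hd, Complex.cpow_ofNat]
  simp only [Pi.mul_apply, coprimeMoebius_apply]
  by_cases hc : d.Coprime m
  · rw [MulChar.one_apply ((ZMod.isUnit_iff_coprime d m).2 hc), if_pos hc]
    simp
  · rw [MulChar.map_nonunit _ (mt (ZMod.isUnit_iff_coprime d m).1 hc), if_neg hc]
    simp

theorem tendsto_sum_totient_mul_div_sq (m : ℕ) [NeZero m] :
    Tendsto (fun n : ℕ => (∑ k ∈ Ioc 0 n, (Nat.totient (m * k) : ℝ)) / (n : ℝ) ^ 2) atTop
      (nhds (3 * Nat.totient m / (π ^ 2 * ∏ q ∈ m.primeFactors, (1 - ((q : ℝ) ^ 2)⁻¹)))) := by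
  have hm : 0 < m := Nat.pos_of_ne_zero (NeZero.ne m)
  have hφ : (Nat.totient m : ℝ) ≠ 0 := by exact_mod_cast (Nat.totient_pos.2 hm).ne'
  have h := (tendsto_sum_mul_id_div_sq _ (abs_coprimeMoebius_le_one m)).const_mul
    (Nat.totient m : ℝ)
  rw [← totientRatio_eq_mul hm] at h
  have hsum : ∑' d : ℕ, coprimeMoebius m d / (2 * (d : ℝ) ^ 2) =
      ((∏ q ∈ m.primeFactors, (1 - ((q : ℝ) ^ 2)⁻¹)) * (π ^ 2 / 6))⁻¹ / 2 := by
    rw [← tsum_coprimeMoebius_div_sq, ← tsum_div_const]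
    exact tsum_congr fun d => by ring
  rw [hsum] at h
  convert h using 2 with n
  · simp only [totientRatio_apply, ← sum_div]
    field_simp
  · rw [mul_inv, div_eq_mul_inv, mul_inv, inv_div]
    ring

theorem phi_sum_multiples_of_2p_limit (p : ℕ) (hp : p.Prime) (hodd : Odd p) :
    Tendsto (fun n : ℕ =>
        (∑ k ∈ Finset.Icc 1 n, (Nat.totient (2 * p * k) : ℝ)) / (2 * (p : ℝ) * n) ^ 2)
      atTop (nhds (1 / (((p : ℝ) + 1) * π ^ 2))) := by
  have hp2 : p ≠ 2 := fun h => by simp [h] at hodd; exact absurd hodd (by decide)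
  have hp0 := hp.pos
  have : NeZero (2 * p) := ⟨by positivity⟩
  have hprod : ∏ q ∈ (2 * p).primeFactors, (1 - ((q : ℝ) ^ 2)⁻¹) =
      (3 / 4) * (1 - ((p : ℝ) ^ 2)⁻¹) := by
    rw [Nat.primeFactors_mul two_ne_zero hp.ne_zero, Nat.prime_two.primeFactors, hp.primeFactors,
      ← insert_eq, prod_pair hp2.symm]
    norm_num
  have htot : (Nat.totient (2 * p) : ℝ) = (p : ℝ) - 1 := by
    rw [Nat.totient_mul ((Nat.coprime_primes Nat.prime_two hp).2 hp2.symm), Nat.totient_prime hp]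
    simp [Nat.cast_sub hp.one_le]
  have h := (tendsto_sum_totient_mul_div_sq (2 * p)).div_const ((2 * (p : ℝ)) ^ 2)
  rw [hprod, htot] at h
  have hp1 : (1 : ℝ) < p := by exact_mod_cast hp.one_lt
  convert h using 2 with n
  · rw [div_div, mul_pow _ (n : ℝ), mul_comm ((n : ℝ) ^ 2)]
    rfl
  · have h1 : (p : ℝ) - 1 ≠ 0 := by linarith
    have h2 : (p : ℝ) + 1 ≠ 0 := by linarith
    have h3 : (p : ℝ) ≠ 0 := by linarith
    rw [show 1 - ((p : ℝ) ^ 2)⁻¹ = (p - 1) * (p + 1) / p ^ 2 by field_simp; ring]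
    field_simp
    norm_num
end

section
/- The limit as n → ∞ of (∑_{k=1}^n φ(6k − 4)) / (6n)² equals 3 / (8π²), and likewise the limit as n → ∞ of (∑_{k=1}^n φ(6k − 2)) / (6n)² equals 3 / (8π²). -/
open Filter Finset Real

open scoped ArithmeticFunction.Moebius

lemma abs_sum_range_natCast_mul_le {u : ℕ → ℝ} (hu : ∀ N, |∑ k ∈ range N, u k| ≤ 1) (N : ℕ) :
    |∑ k ∈ range N, (k : ℝ) * u k| ≤ 2 * N := by
  have key : ∀ N : ℕ, ∑ k ∈ range N, (k : ℝ) * u k =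
      N * ∑ k ∈ range N, u k - ∑ j ∈ range N, ∑ k ∈ range (j + 1), u k := by
    intro N
    induction N with
    | zero => simp
    | succ N ih =>
      simp only [sum_range_succ] at ih ⊢
      rw [ih]
      push_cast
      ring
  rw [key]
  have h₁ : |(N : ℝ) * ∑ k ∈ range N, u k| ≤ N := by
    rw [abs_mul, Nat.abs_cast]
    exact mul_le_of_le_one_right N.cast_nonneg (hu N)
  have h₂ : |∑ j ∈ range N, ∑ k ∈ range (j + 1), u k| ≤ N := by
    refine (abs_sum_le_sum_abs _ _).trans ((sum_le_sum fun j _ => hu (j + 1)).trans ?_)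
    simp
  linarith [abs_sub (N * ∑ k ∈ range N, u k) (∑ j ∈ range N, ∑ k ∈ range (j + 1), u k)]

lemma abs_sum_range_modEq_sub_inv_le {e : ℕ} (he : 0 < e) (r N : ℕ) :
    |∑ k ∈ range N, ((if k ≡ r [MOD e] then 1 else 0) - (e : ℝ)⁻¹)| ≤ 1 := by
  have he' : (0 : ℝ) < e := by exact_mod_cast he
  have hcount : ∑ k ∈ range N, (if k ≡ r [MOD e] then (1 : ℝ) else 0) =
      (N / e : ℕ) + if r % e < N % e then 1 else 0 := by
    rw [sum_boole, ← Nat.count_eq_card_filter_range, Nat.count_modEq_card _ he]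
    push_cast
    rfl
  have hdiv : (N : ℝ) * (e : ℝ)⁻¹ = (N / e : ℕ) + (N % e : ℕ) * (e : ℝ)⁻¹ := by
    have : (N : ℝ) = e * (N / e : ℕ) + (N % e : ℕ) := by exact_mod_cast (Nat.div_add_mod N e).symm
    rw [this]
    field_simp
  have h₀ : 0 ≤ ((N % e : ℕ) : ℝ) * (e : ℝ)⁻¹ := by positivity
  have h₁ : ((N % e : ℕ) : ℝ) * (e : ℝ)⁻¹ ≤ 1 := by
    rw [← div_eq_mul_inv, div_le_one he']
    exact_mod_cast (Nat.mod_lt N he).le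
  rw [sum_sub_distrib, hcount, sum_const, card_range, nsmul_eq_mul, hdiv, abs_le]
  split_ifs <;> constructor <;> linarith

lemma tendsto_sum_modEq_div_sq {e : ℕ} (he : 0 < e) (r : ℕ) :
    Tendsto (fun n : ℕ => (∑ k ∈ Icc 1 n, if k ≡ r [MOD e] then (k : ℝ) else 0) / (n : ℝ) ^ 2)
      atTop (nhds (2 * e : ℝ)⁻¹) := by
  have hinv : Tendsto (fun n : ℕ => (n : ℝ)⁻¹) atTop (nhds 0) :=
    tendsto_inv_atTop_nhds_zero_nat
  have hmain : Tendsto (fun n : ℕ => (1 + (n : ℝ)⁻¹) * (2 * e : ℝ)⁻¹) atTop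
      (nhds (2 * e : ℝ)⁻¹) := by
    simpa using (hinv.const_add 1).mul_const (2 * e : ℝ)⁻¹
  refine tendsto_of_tendsto_of_dist hmain ?_
  refine squeeze_zero' (g := fun n : ℕ => 4 * (n : ℝ)⁻¹) (.of_forall fun n => dist_nonneg) ?_
    (by simpa using hinv.const_mul 4)
  filter_upwards [eventually_ge_atTop 1] with n hn
  have hn' : (1 : ℝ) ≤ n := by exact_mod_cast hn
  have hbound := abs_sum_range_natCast_mul_le (abs_sum_range_modEq_sub_inv_le he r) (n + 1)
  have hIcc : ∑ k ∈ Icc 1 n, (if k ≡ r [MOD e] then (k : ℝ) else 0) =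
      ∑ k ∈ range (n + 1), (k : ℝ) * (if k ≡ r [MOD e] then 1 else 0) := by
    rw [range_eq_Ico, sum_eq_sum_Ico_succ_bot n.succ_pos, ← Finset.Ico_add_one_right_eq_Icc]
    simp
  have hgauss : ∑ k ∈ range (n + 1), (k : ℝ) = n * (n + 1) / 2 := by
    have := sum_range_id_mul_two (n + 1)
    have h : (∑ k ∈ range (n + 1), (k : ℝ)) * 2 = (n + 1) * n := by
      rw [Nat.add_sub_cancel] at this
      simpa using congrArg (Nat.cast : ℕ → ℝ) this
    linarith
  simp only [mul_sub, sum_sub_distrib, ← sum_mul, ← hIcc, hgauss] at hbound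
  have he' : (0 : ℝ) < e := by exact_mod_cast he
  rw [dist_comm, Real.dist_eq]
  have : (∑ k ∈ Icc 1 n, (if k ≡ r [MOD e] then (k : ℝ) else 0)) / (n : ℝ) ^ 2 -
      (1 + (n : ℝ)⁻¹) * (2 * e : ℝ)⁻¹ =
      (∑ k ∈ Icc 1 n, (if k ≡ r [MOD e] then (k : ℝ) else 0) - n * (n + 1) / 2 * (e : ℝ)⁻¹) /
        (n : ℝ) ^ 2 := by
    field_simp
  rw [this, abs_div, abs_of_nonneg (by positivity : (0 : ℝ) ≤ (n : ℝ) ^ 2),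
    div_le_iff₀ (by positivity)]
  refine hbound.trans ?_
  push_cast
  field_simp
  linarith

lemma totient_eq_sum_moebius {m : ℕ} (hm : 0 < m) :
    (m.totient : ℝ) = ∑ d ∈ m.divisors, (μ d : ℝ) / d * m := by
  have h := (ArithmeticFunction.sum_eq_iff_sum_mul_moebius_eq
    (f := fun n => (n.totient : ℝ)) (g := fun n => (n : ℝ))).mp
    (fun n _ => by exact_mod_cast n.sum_totient) m hm
  rw [← h, Nat.sum_divisorsAntidiagonal (fun i j => (μ i : ℝ) * (j : ℝ))]
  refine sum_congr rfl fun d hd => ?_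
  rw [Nat.cast_div (Nat.dvd_of_mem_divisors hd)
    (by exact_mod_cast (Nat.pos_of_mem_divisors hd).ne'), mul_div_assoc', div_mul_eq_mul_div]

/-- `μ(d) gcd(d, 2) / d ^ 2` for `d` coprime to `3`, and `0` otherwise. -/
noncomputable def twistedMoebius (d : ℕ) : ℝ :=
  if 3 ∣ d then 0 else (μ d : ℝ) * (d.gcd 2 : ℕ) / (d : ℝ) ^ 2

lemma abs_moebius_cast_le_one (d : ℕ) : |(μ d : ℝ)| ≤ 1 := by
  exact_mod_cast ArithmeticFunction.abs_moebius_le_one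

lemma summable_norm_twistedMoebius : Summable (fun d => ‖twistedMoebius d‖) := by
  refine Summable.of_nonneg_of_le (fun d => norm_nonneg _) (fun d => ?_)
    (hasSum_zeta_two.summable.mul_left 2)
  unfold twistedMoebius
  split_ifs
  · simp
  · have h2 : ((d.gcd 2 : ℕ) : ℝ) ≤ 2 := by
      exact_mod_cast Nat.le_of_dvd two_pos (Nat.gcd_dvd_right d 2)
    rw [norm_div, norm_mul, Real.norm_eq_abs, Real.norm_natCast, norm_pow, Real.norm_natCast,
      mul_one_div]
    gcongr
    nlinarith [abs_moebius_cast_le_one d, abs_nonneg (μ d : ℝ)]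

lemma twistedMoebius_mul {m n : ℕ} (h : m.Coprime n) :
    twistedMoebius (m * n) = twistedMoebius m * twistedMoebius n := by
  unfold twistedMoebius
  rw [ArithmeticFunction.isMultiplicative_moebius.map_mul_of_coprime h,
    Nat.gcd_comm (m * n), Nat.Coprime.gcd_mul 2 h, Nat.gcd_comm 2, Nat.gcd_comm 2]
  by_cases hm : 3 ∣ m <;> by_cases hn : 3 ∣ n <;> 
    simp [hm, hn, Nat.prime_three.dvd_mul]
  ring

lemma tsum_twistedMoebius_prime_pow {p : ℕ} (hp : p.Prime) :
    ∑' e, twistedMoebius (p ^ e) = 1 + twistedMoebius p := by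
  rw [tsum_eq_sum (s := range 2)]
  · simp [sum_range_succ, twistedMoebius]
  · intro e he
    have h : e ≠ 0 ∧ e ≠ 1 := by simp at he; omega
    simp [twistedMoebius, ArithmeticFunction.moebius_apply_prime_pow hp h.1, h.2]

lemma one_add_twistedMoebius_of_three_lt {p : ℕ} (hp : p.Prime) (h : 3 < p) :
    1 + twistedMoebius p = 1 - ((p : ℝ) ^ 2)⁻¹ := by
  have h3 : ¬ 3 ∣ p := fun h' => by
    have := (Nat.prime_dvd_prime_iff_eq Nat.prime_three hp).mp h'
    omega
  have h2 : p.gcd 2 = 1 := (Nat.coprime_primes hp Nat.prime_two).mpr (by omega)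
  simp [twistedMoebius, h3, h2, ArithmeticFunction.moebius_apply_prime hp]
  ring

lemma tsum_twistedMoebius : ∑' d, twistedMoebius d = 9 / (2 * π ^ 2) := by
  have hprod := EulerProduct.eulerProduct_hasProd (f := twistedMoebius) (by simp [twistedMoebius])
    twistedMoebius_mul summable_norm_twistedMoebius (by simp [twistedMoebius])
  let f : ℕ →*₀ ℝ :=
    { toFun := fun n => ((n : ℝ) ^ 2)⁻¹
      map_zero' := by simp
      map_one' := by simp
      map_mul' := fun m n => by push_cast; ring }
  have hsum : HasSum f (π ^ 2 / 6) := by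
    simpa [f] using! hasSum_zeta_two
  have hzeta := EulerProduct.eulerProduct_completely_multiplicative_hasProd (f := f)
    hsum.summable.norm
  rw [hsum.tsum_eq] at hzeta
  have hmul := hprod.mul hzeta
  obtain ⟨p₂, hp₂⟩ : ∃ p : Nat.Primes, (p : ℕ) = 2 := ⟨⟨2, Nat.prime_two⟩, rfl⟩
  obtain ⟨p₃, hp₃⟩ : ∃ p : Nat.Primes, (p : ℕ) = 3 := ⟨⟨3, Nat.prime_three⟩, rfl⟩
  have hfin := hasProd_prod_of_ne_finset_one (L := .unconditional _)
    (f := fun p : Nat.Primes => (∑' e, twistedMoebius (p ^ e)) * (1 - f p)⁻¹)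
    (s := {p₂, p₃}) (by
      intro p hp
      have h : 3 < (p : ℕ) := by
        have h2 := p.2.two_le
        have hne2 : (p : ℕ) ≠ 2 := fun h => hp (mem_insert.mpr (.inl (Subtype.ext (h.trans hp₂.symm))))
        have hne3 : (p : ℕ) ≠ 3 := fun h => hp
          (mem_insert_of_mem (mem_singleton.mpr (Subtype.ext (h.trans hp₃.symm))))
        omega
      rw [tsum_twistedMoebius_prime_pow p.2, one_add_twistedMoebius_of_three_lt p.2 h]
      refine mul_inv_cancel₀ (sub_ne_zero.mpr (ne_of_gt ?_))
      exact inv_lt_one_of_one_lt₀ (one_lt_pow₀ (by exact_mod_cast p.2.one_lt) two_ne_zero))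
  have h := hmul.unique hfin
  rw [prod_pair (by rintro rfl; omega), hp₂, hp₃] at h
  simp only [tsum_twistedMoebius_prime_pow Nat.prime_two,
    tsum_twistedMoebius_prime_pow Nat.prime_three] at h
  have v2 : twistedMoebius 2 = -1 / 2 := by
    norm_num [twistedMoebius, ArithmeticFunction.moebius_apply_prime Nat.prime_two]
  have v3 : twistedMoebius 3 = 0 := by simp [twistedMoebius]
  have f2 : f 2 = 1 / 4 := by norm_num [f]
  have f3 : f 3 = 1 / 9 := by norm_num [f]
  rw [v2, v3, f2, f3] at h
  have hpi : π ^ 2 ≠ 0 := by positivity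
  field_simp
  norm_num at h
  linarith

/-- For `d` coprime to `3`, the `k` with `d ∣ 2 * (3 * k - b)` form one residue class. -/
lemma exists_dvd_two_mul_three_mul_sub_iff {d b : ℕ} (hd : 0 < d) (h3 : ¬ 3 ∣ d) (hb : b ≤ 2) :
    ∃ r, ∀ k, 1 ≤ k → (d ∣ 2 * (3 * k - b) ↔ k ≡ r [MOD d / d.gcd 2]) := by
  have hg : 0 < d.gcd 2 := Nat.gcd_pos_of_pos_left 2 hd
  have hcop : Nat.Coprime (d / d.gcd 2) 3 := by
    refine Nat.Coprime.symm ((Nat.prime_three.coprime_iff_not_dvd).mpr fun h => h3 ?_)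
    exact h.trans (Nat.div_dvd_of_dvd (Nat.gcd_dvd_left d 2))
  obtain ⟨r, hr⟩ : ∃ r, 3 * r ≡ b [MOD d / d.gcd 2] := by
    obtain ⟨x, hx, hx3⟩ := Nat.chineseRemainder hcop b 0
    obtain ⟨c, rfl⟩ := Nat.modEq_zero_iff_dvd.mp hx3
    exact ⟨c, hx⟩
  refine ⟨r, fun k hk => ?_⟩
  have h1 : d ∣ 2 * (3 * k - b) ↔ d / d.gcd 2 ∣ 3 * k - b := by
    have hc := Nat.coprime_div_gcd_div_gcd hg
    conv_lhs => rw [← Nat.mul_div_cancel' (Nat.gcd_dvd_left d 2)]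
    conv_lhs => rhs; rw [← Nat.mul_div_cancel' (Nat.gcd_dvd_right d 2)]
    rw [mul_assoc, Nat.mul_dvd_mul_iff_left hg, hc.dvd_mul_left]
  rw [h1, ← Nat.modEq_iff_dvd' (by omega)]
  constructor
  · intro h
    exact Nat.ModEq.cancel_left_of_coprime hcop (h.symm.trans hr.symm)
  · intro h
    exact ((h.mul_left 3).trans hr).symm

lemma card_filter_dvd_le (d n b : ℕ) (hb : 1 ≤ b) (hb' : b ≤ 2) :
    #{k ∈ Icc 1 n | d ∣ 2 * (3 * k - b)} ≤ 6 * n / d := by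
  rw [← Nat.Ioc_filter_dvd_card_eq_div]
  refine card_le_card_of_injOn (fun k => 2 * (3 * k - b)) ?_ ?_
  · intro k hk
    simp at hk ⊢
    refine ⟨by omega, hk.2⟩
  · intro k hk l hl h
    simp at hk hl h
    omega

lemma tendsto_moebius_mul_sum_div_sq (d : ℕ) {b : ℕ} (hb : 1 ≤ b) (hb' : b ≤ 2) :
    Tendsto (fun n : ℕ => (μ d : ℝ) / d * (∑ k ∈ Icc 1 n, if d ∣ 2 * (3 * k - b) then
      ((2 * (3 * k - b) : ℕ) : ℝ) else 0) / (6 * (n : ℝ)) ^ 2)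
      atTop (nhds (twistedMoebius d / 12)) := by
  rcases d.eq_zero_or_pos with rfl | hd
  · simp [twistedMoebius]
  by_cases h3 : 3 ∣ d
  · have h0 : ∀ n : ℕ, (∑ k ∈ Icc 1 n, if d ∣ 2 * (3 * k - b) then
        ((2 * (3 * k - b) : ℕ) : ℝ) else 0) = 0 := fun n => sum_eq_zero fun k hk => by
      rw [if_neg]
      intro h
      have := h3.trans h
      have := (mem_Icc.mp hk).1
      omega
    simp only [h0, twistedMoebius, if_pos h3]
    simp
  obtain ⟨r, hr⟩ := exists_dvd_two_mul_three_mul_sub_iff hd h3 hb'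
  have hg : 0 < d.gcd 2 := Nat.gcd_pos_of_pos_left 2 hd
  have he : 0 < d / d.gcd 2 := Nat.div_pos (Nat.gcd_le_left 2 hd) hg
  have hcast : ((d / d.gcd 2 : ℕ) : ℝ) = d / (d.gcd 2 : ℕ) :=
    Nat.cast_div (Nat.gcd_dvd_left d 2) (by exact_mod_cast hg.ne')
  have hsum : ∀ n : ℕ, (∑ k ∈ Icc 1 n, if d ∣ 2 * (3 * k - b) then
      ((2 * (3 * k - b) : ℕ) : ℝ) else 0) =
      6 * (∑ k ∈ Icc 1 n, if k ≡ r [MOD d / d.gcd 2] then (k : ℝ) else 0) -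
      2 * b * (#{k ∈ Icc 1 n | k ≡ r [MOD d / d.gcd 2]} : ℕ) := by
    intro n
    rw [← sum_boole, mul_sum, mul_sum, ← sum_sub_distrib]
    refine sum_congr rfl fun k hk => ?_
    have hk' := (mem_Icc.mp hk).1
    simp only [hr k hk']
    split_ifs
    · push_cast [show b ≤ 3 * k by omega]
      ring
    · simp
  have hcard : Tendsto (fun n : ℕ =>
      ((#{k ∈ Icc 1 n | k ≡ r [MOD d / d.gcd 2]} : ℕ) : ℝ) / (n : ℝ) ^ 2) atTop (nhds 0) := by
    refine squeeze_zero (fun n => by positivity) (fun n => ?_)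
      (tendsto_inv_atTop_nhds_zero_nat (𝕜 := ℝ))
    have h : ((#{k ∈ Icc 1 n | k ≡ r [MOD d / d.gcd 2]} : ℕ) : ℝ) ≤ n := by
      exact_mod_cast (card_filter_le _ _).trans (by simp)
    rcases n.eq_zero_or_pos with rfl | hn
    · simp
    · have hn' : (0 : ℝ) < n := by exact_mod_cast hn
      rw [div_le_iff₀ (by positivity)]
      field_simp
      exact h
  have hlim := ((((tendsto_sum_modEq_div_sq he r).const_mul 6).sub
    (hcard.const_mul (2 * b : ℝ))).const_mul ((μ d : ℝ) / d)).div_const 36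
  have hval : (μ d : ℝ) / d * (6 * (2 * (d / d.gcd 2 : ℕ) : ℝ)⁻¹ - 2 * b * 0) / 36 =
      twistedMoebius d / 12 := by
    have hd' : (d : ℝ) ≠ 0 := by exact_mod_cast hd.ne'
    have hg' : ((d.gcd 2 : ℕ) : ℝ) ≠ 0 := by exact_mod_cast hg.ne'
    rw [hcast, twistedMoebius, if_neg h3]
    field_simp
    ring
  rw [hval] at hlim
  refine hlim.congr fun n => ?_
  rw [hsum]
  ring

lemma sum_totient_eq_tsum (n : ℕ) {b : ℕ} (hb' : b ≤ 2) :
    ∑ k ∈ Icc 1 n, ((2 * (3 * k - b)).totient : ℝ) =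
      ∑' d : ℕ, (μ d : ℝ) / d * ∑ k ∈ Icc 1 n, if d ∣ 2 * (3 * k - b) then
        ((2 * (3 * k - b) : ℕ) : ℝ) else 0 := by
  rw [tsum_eq_sum (s := Icc 1 (6 * n))]
  · simp_rw [mul_sum]
    rw [sum_comm]
    refine sum_congr rfl fun k hk => ?_
    have hk' := mem_Icc.mp hk
    have hpos : 0 < 2 * (3 * k - b) := by omega
    rw [totient_eq_sum_moebius hpos]
    simp_rw [mul_ite, mul_zero]
    rw [← sum_filter]
    refine sum_congr ?_ fun _ _ => rfl
    ext d
    simp only [Nat.mem_divisors, mem_filter, mem_Icc]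
    constructor
    · rintro ⟨h, -⟩
      exact ⟨⟨Nat.pos_of_dvd_of_pos h hpos, (Nat.le_of_dvd hpos h).trans (by omega)⟩, h⟩
    · exact fun h => ⟨h.2, hpos.ne'⟩
  · intro d hd
    rw [sum_eq_zero, mul_zero]
    intro k hk
    have hk' := mem_Icc.mp hk
    have hpos : 0 < 2 * (3 * k - b) := by omega
    refine if_neg fun h => hd (mem_Icc.mpr ⟨Nat.pos_of_dvd_of_pos h hpos, ?_⟩)
    exact (Nat.le_of_dvd hpos h).trans (by omega)

lemma norm_moebius_mul_sum_div_sq_le (d n : ℕ) {b : ℕ} (hb : 1 ≤ b) (hb' : b ≤ 2) :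
    ‖(μ d : ℝ) / d * (∑ k ∈ Icc 1 n, if d ∣ 2 * (3 * k - b) then
      ((2 * (3 * k - b) : ℕ) : ℝ) else 0) / (6 * (n : ℝ)) ^ 2‖ ≤ 1 / (d : ℝ) ^ 2 := by
  rcases n.eq_zero_or_pos with rfl | hn
  · simp
  have hn' : (0 : ℝ) < n := by exact_mod_cast hn
  have hsum : (∑ k ∈ Icc 1 n, if d ∣ 2 * (3 * k - b) then
      ((2 * (3 * k - b) : ℕ) : ℝ) else 0) ≤ (6 * n) * (6 * n / d) := by
    rw [← sum_filter]
    have h : ((#{k ∈ Icc 1 n | d ∣ 2 * (3 * k - b)} : ℕ) : ℝ) ≤ 6 * n / d :=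
      (Nat.cast_le.mpr (card_filter_dvd_le d n b hb hb')).trans
        (Nat.cast_div_le.trans (by push_cast; rfl))
    refine (sum_le_card_nsmul _ _ (6 * n : ℝ) fun k hk => ?_).trans ?_
    · have hk' := mem_Icc.mp (mem_filter.mp hk).1
      exact_mod_cast (by omega : 2 * (3 * k - b) ≤ 6 * n)
    · rw [nsmul_eq_mul, mul_comm]
      gcongr
  have hnonneg : 0 ≤ ∑ k ∈ Icc 1 n, if d ∣ 2 * (3 * k - b) then
      ((2 * (3 * k - b) : ℕ) : ℝ) else 0 := sum_nonneg fun k _ => by positivity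
  rw [norm_div, norm_mul, norm_div, Real.norm_eq_abs (μ d : ℝ), Real.norm_natCast,
    Real.norm_of_nonneg hnonneg, Real.norm_of_nonneg (sq_nonneg _), div_le_iff₀ (by positivity)]
  calc |(μ d : ℝ)| / d * _ ≤ 1 / d * ((6 * n) * (6 * n / d)) := by
        gcongr
        exact abs_moebius_cast_le_one d
    _ = 1 / (d : ℝ) ^ 2 * (6 * n) ^ 2 := by ring

lemma tendsto_sum_totient_two_mul_three_mul_sub {b : ℕ} (hb : 1 ≤ b) (hb' : b ≤ 2) :
    Tendsto (fun n : ℕ =>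
        (∑ k ∈ Icc 1 n, ((2 * (3 * k - b)).totient : ℝ)) / (6 * (n : ℝ)) ^ 2)
      atTop (nhds (3 / (8 * π ^ 2))) := by
  have h := tendsto_tsum_of_dominated_convergence hasSum_zeta_two.summable
    (fun d => tendsto_moebius_mul_sum_div_sq d hb hb')
    (.of_forall fun n d => norm_moebius_mul_sum_div_sq_le d n hb hb')
  rw [tsum_div_const, tsum_twistedMoebius,
    show 9 / (2 * π ^ 2) / 12 = 3 / (8 * π ^ 2) by field_simp; norm_num] at h
  refine h.congr fun n => ?_
  rw [sum_totient_eq_tsum n hb', tsum_div_const]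

theorem phi_sum_6k_sub_4_and_6k_sub_2_limit :
    Tendsto (fun n : ℕ =>
        (∑ k ∈ Finset.Icc 1 n, (Nat.totient (6 * k - 4) : ℝ)) / (6 * (n : ℝ)) ^ 2)
      atTop (nhds (3 / (8 * π ^ 2))) ∧
    Tendsto (fun n : ℕ =>
        (∑ k ∈ Finset.Icc 1 n, (Nat.totient (6 * k - 2) : ℝ)) / (6 * (n : ℝ)) ^ 2)
      atTop (nhds (3 / (8 * π ^ 2))) := by
  have h4 : ∀ k, 6 * k - 4 = 2 * (3 * k - 2) := by omega
  have h2 : ∀ k, 6 * k - 2 = 2 * (3 * k - 1) := by omega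
  simp only [h4, h2]
  exact ⟨tendsto_sum_totient_two_mul_three_mul_sub one_le_two le_rfl,
    tendsto_sum_totient_two_mul_three_mul_sub le_rfl one_le_two⟩
end

section
/- The limit as n → ∞ of (∑_{k=1}^n φ(6k − 5)) / (6n)² equals 3 / (4π²), and likewise the limit as n → ∞ of (∑_{k=1}^n φ(6k − 1)) / (6n)² equals 3 / (4π²). -/
open Filter Finset Real

open scoped ArithmeticFunction.Moebius

/-- The sum of the positive integers up to `N` congruent to `r` modulo `6`. -/
def sumModSix (r N : ℕ) : ℕ := ∑ e ∈ Ioc 0 N, if e % 6 = r then e else 0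

lemma sum_Ioc_zero_add_six {M : Type*} [AddCommMonoid M] (f : ℕ → M) (N : ℕ) :
    ∑ m ∈ Ioc 0 (N + 6), f m =
      ∑ m ∈ Ioc 0 N, f m + f (N + 1) + f (N + 2) + f (N + 3) + f (N + 4) + f (N + 5)
        + f (N + 6) := by
  simp only [← Finset.Icc_add_one_left_eq_Ioc, zero_add]
  iterate 6 rw [Finset.sum_Icc_succ_top (by omega)]

lemma sumModSix_add_six {r : ℕ} (hr : r < 6) (N : ℕ) :
    ∃ x, N + 1 ≤ x ∧ x ≤ N + 6 ∧ sumModSix r (N + 6) = sumModSix r N + x := by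
  simp only [sumModSix]
  rw [sum_Ioc_zero_add_six]
  refine ⟨_, ?_, ?_, by simp only [add_assoc]; rfl⟩ <;> grind

lemma abs_twelve_mul_sumModSix_sub_sq_le {r : ℕ} (hr : r < 6) (N : ℕ) :
    |12 * (sumModSix r N : ℝ) - (N : ℝ) ^ 2| ≤ 12 * (N : ℝ) := by
  induction N using Nat.strong_induction_on with
  | _ N ih =>
    rcases lt_or_ge N 6 with h | h
    · have h1 : sumModSix r N ≤ N := by
        unfold sumModSix
        interval_cases N <;> interval_cases r <;> decide
      have h2 : (sumModSix r N : ℝ) ≤ N := mod_cast h1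
      have h3 : (0 : ℝ) ≤ sumModSix r N := Nat.cast_nonneg _
      have h4 : (N : ℝ) < 6 := mod_cast h
      rw [abs_le]
      constructor <;> nlinarith
    · obtain ⟨K, rfl⟩ := Nat.exists_eq_add_of_le' h
      obtain ⟨x, hx1, hx2, hx⟩ := sumModSix_add_six hr K
      have hK := abs_le.1 (ih K (by omega))
      rw [hx, abs_le]
      have h1 : (K : ℝ) + 1 ≤ x := mod_cast hx1
      have h2 : (x : ℝ) ≤ K + 6 := mod_cast hx2
      push_cast
      constructor <;> nlinarith

lemma sumModSix_le_sq (r N : ℕ) : sumModSix r N ≤ N ^ 2 := by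
  calc sumModSix r N ≤ ∑ e ∈ Ioc 0 N, N := by
        refine Finset.sum_le_sum fun e he => ?_
        have := (Finset.mem_Ioc.1 he).2
        split_ifs <;> omega
    _ = N ^ 2 := by simp [sq]

lemma sum_Ioc_ite_mul_mod_six {a d : ℕ} (ha : a.Coprime 6) (N : ℕ) :
    (∑ e ∈ Ioc 0 N, if d * e % 6 = a % 6 then e else 0) =
      if d.Coprime 6 then sumModSix (d * a % 6) N else 0 := by
  split_ifs with hd
  · refine Finset.sum_congr rfl fun e _ => ?_
    have hd2 : d * d ≡ 1 [MOD 6] := by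
      have h : (d % 6).gcd 6 = 1 := by rw [← Nat.gcd_rec]; exact hd.symm
      have hlt := Nat.mod_lt d (by norm_num : 6 > 0)
      rw [Nat.ModEq, Nat.mul_mod]
      generalize d % 6 = x at h hlt
      interval_cases x <;> simp_all
    have key : d * e ≡ a [MOD 6] ↔ e ≡ d * a [MOD 6] := by
      constructor <;> intro h
      · simpa [mul_assoc] using (hd2.mul_right e).symm.trans (by rw [mul_assoc]; exact h.mul_left d)
      · simpa [mul_assoc] using (h.mul_left d).trans (by simpa [mul_assoc] using hd2.mul_right a)
    simp only [Nat.ModEq] at key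
    simp only [key]
  · refine Finset.sum_eq_zero fun e _ => if_neg fun h => hd ?_
    have : (d * e).Coprime 6 := by
      rw [Nat.Coprime, ← Nat.ModEq.gcd_eq h.symm]; exact ha
    exact Nat.Coprime.coprime_mul_right this

lemma totient_eq_sum_moebius_mul_s13 {m : ℕ} (hm : 0 < m) :
    (m.totient : ℝ) = ∑ x ∈ m.divisorsAntidiagonal, (μ x.1 : ℝ) * x.2 := by
  refine ((ArithmeticFunction.sum_eq_iff_sum_mul_moebius_eq (R := ℝ)
    (f := fun m => (m.totient : ℝ)) (g := fun m => (m : ℝ))).1 (fun n _ => ?_) m hm).symm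
  exact_mod_cast Nat.sum_totient n

lemma sum_Ioc_mul_totient (g : ℕ → ℝ) (N : ℕ) :
    ∑ m ∈ Ioc 0 N, g m * m.totient =
      ∑ d ∈ Ioc 0 N, (μ d : ℝ) * ∑ e ∈ Ioc 0 (N / d), g (d * e) * e := by
  calc ∑ m ∈ Ioc 0 N, g m * m.totient
      = ∑ m ∈ Ioc 0 N, ∑ x ∈ m.divisorsAntidiagonal, (μ x.1 : ℝ) * (g (x.1 * x.2) * x.2) := by
        refine Finset.sum_congr rfl fun m hm => ?_
        rw [totient_eq_sum_moebius_mul_s13 (Finset.mem_Ioc.1 hm).1, Finset.mul_sum]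
        refine Finset.sum_congr rfl fun x hx => ?_
        rw [(Nat.mem_divisorsAntidiagonal.1 hx).1]
        ring
    _ = ∑ d ∈ Ioc 0 N, ∑ e ∈ Ioc 0 (N / d), (μ d : ℝ) * (g (d * e) * e) := by
        rw [Finset.sum_sigma', Finset.sum_sigma']
        refine Finset.sum_bij' (fun x _ => ⟨x.2.1, x.2.2⟩)
          (fun y _ => ⟨y.1 * y.2, (y.1, y.2)⟩) ?_ ?_ ?_ ?_ ?_
        · rintro ⟨m, d, e⟩ h
          simp only [Finset.mem_sigma, Finset.mem_Ioc, Nat.mem_divisorsAntidiagonal] at h ⊢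
          obtain ⟨⟨h1, h2⟩, rfl, h3⟩ := h
          have hd := Nat.pos_of_mul_pos_right h1
          have he := Nat.pos_of_mul_pos_left h1
          refine ⟨⟨?_, ?_⟩, ?_, ?_⟩
          · exact hd
          · nlinarith
          · exact he
          · rw [Nat.le_div_iff_mul_le hd]; linarith
        · rintro ⟨d, e⟩ h
          simp only [Finset.mem_sigma, Finset.mem_Ioc, Nat.mem_divisorsAntidiagonal] at h ⊢
          obtain ⟨⟨h1, h2⟩, h3, h4⟩ := h
          rw [Nat.le_div_iff_mul_le h1] at h4
          have := Nat.mul_pos h1 h3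
          exact ⟨⟨this, by linarith⟩, trivial, this.ne'⟩
        · rintro ⟨m, d, e⟩ h
          simp only [Finset.mem_sigma, Nat.mem_divisorsAntidiagonal] at h
          obtain ⟨-, rfl, -⟩ := h
          rfl
        · rintro ⟨d, e⟩ h
          rfl
        · rintro ⟨m, d, e⟩ h
          rfl
    _ = _ := by simp only [Finset.mul_sum]

lemma tendsto_sumModSix_div {r : ℕ} (hr : r < 6) (d : ℕ) :
    Tendsto (fun n : ℕ => (sumModSix r (6 * n / d) : ℝ) / (6 * (n : ℝ)) ^ 2) atTop
      (nhds (1 / 12 * (1 / (d : ℝ) ^ 2))) := by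
  have h1 : Tendsto (fun n : ℕ => ((6 * n / d : ℕ) : ℝ) / (6 * (n : ℝ))) atTop
      (nhds (1 / (d : ℝ))) := by
    have h := (tendsto_nat_floor_mul_div_atTop (R := ℝ) (a := 1 / (d : ℝ)) (by positivity)).comp
      ((tendsto_natCast_atTop_atTop (R := ℝ)).comp
        (tendsto_id.const_mul_atTop' (show 0 < 6 by norm_num)))
    refine h.congr fun n => ?_
    have : ⌊1 / (d : ℝ) * ((6 * n : ℕ) : ℝ)⌋₊ = 6 * n / d := by
      rw [one_div_mul_eq_div, Nat.floor_div_eq_div]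
    simp only [Function.comp_apply, id]
    rw [this]
    push_cast
    rfl
  have h2 := (h1.pow 2).const_mul (1 / 12 : ℝ)
  rw [one_div_pow] at h2
  have h3 := (h1.mul (tendsto_const_div_atTop_nhds_zero_nat (1 / 6 : ℝ)))
  rw [mul_zero] at h3
  refine tendsto_of_tendsto_of_dist h2 (squeeze_zero (fun _ => dist_nonneg) (fun n => ?_) h3)
  rw [Real.dist_eq]
  rcases Nat.eq_zero_or_pos n with rfl | hn
  · simp
  have h := abs_twelve_mul_sumModSix_sub_sq_le hr (6 * n / d)
  set M := 6 * n / d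
  have hn' : (0 : ℝ) < n := mod_cast hn
  have e1 : 1 / 12 * ((M : ℝ) / (6 * n)) ^ 2 - (sumModSix r M : ℝ) / (6 * (n : ℝ)) ^ 2
      = -(12 * (sumModSix r M : ℝ) - (M : ℝ) ^ 2) / (12 * (6 * (n : ℝ)) ^ 2) := by
    field_simp; ring
  rw [e1, abs_div, abs_neg, abs_of_pos (by positivity : 0 < 12 * (6 * (n : ℝ)) ^ 2),
    div_le_iff₀ (by positivity)]
  refine h.trans (le_of_eq ?_)
  field_simp

lemma tsum_coprime_six_moebius_div_sq :
    ∑' d : ℕ, (if d.Coprime 6 then (μ d : ℝ) / (d : ℝ) ^ 2 else 0) = 9 / π ^ 2 := by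
  have hs : (1 : ℝ) < (2 : ℂ).re := by norm_num
  have hone := DirichletCharacter.LSeries.mul_mu_eq_one (1 : DirichletCharacter ℂ 6) hs
  rw [← DirichletCharacter.LFunction_eq_LSeries _ hs,
    show DirichletCharacter.LFunction (1 : DirichletCharacter ℂ 6) 2 = _ from
      DirichletCharacter.LFunctionTrivChar_eq_mul_riemannZeta (by norm_num), riemannZeta_two,
    show Nat.primeFactors 6 = {2, 3} by
      rw [show 6 = 2 * 3 by norm_num, Nat.primeFactors_mul (by norm_num) (by norm_num),
        Nat.prime_two.primeFactors, Nat.prime_three.primeFactors]; rfl,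
    Finset.prod_pair (by norm_num)] at hone
  have hL : LSeries
      ((fun n : ℕ => (1 : DirichletCharacter ℂ 6) n) * fun n : ℕ => ((μ n : ℤ) : ℂ)) 2 =
      ((∑' d : ℕ, (if d.Coprime 6 then (μ d : ℝ) / (d : ℝ) ^ 2 else 0) : ℝ) : ℂ) := by
    rw [LSeries, Complex.ofReal_tsum]
    refine tsum_congr fun d => ?_
    rw [LSeries.term_def]
    rcases eq_or_ne d 0 with rfl | hd
    · simp
    rw [if_neg hd]
    split_ifs with h
    · have : IsUnit (d : ZMod 6) := (ZMod.isUnit_iff_coprime d 6).2 h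
      simp [MulChar.one_apply this]
    · have : ¬ IsUnit (d : ZMod 6) := fun h' => h ((ZMod.isUnit_iff_coprime d 6).1 h')
      simp [MulChar.map_nonunit _ this]
  rw [hL] at hone
  have h4 : (((2 : ℕ) : ℂ)) ^ (-2 : ℂ) = 1 / 4 := by
    rw [Complex.cpow_neg]; norm_num
  have h9 : (((3 : ℕ) : ℂ)) ^ (-2 : ℂ) = 1 / 9 := by
    rw [Complex.cpow_neg]; norm_num
  rw [h4, h9] at hone
  generalize ∑' d : ℕ, (if d.Coprime 6 then (μ d : ℝ) / (d : ℝ) ^ 2 else 0) = T at hone ⊢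
  have hreal : (1 - 1 / 4) * (1 - 1 / 9) * (π ^ 2 / 6) * T = 1 := by
    apply Complex.ofReal_injective
    push_cast
    exact hone
  rw [eq_div_iff (by positivity)]
  linarith

lemma tendsto_sum_totient_mod_six {a : ℕ} (ha : a.Coprime 6) :
    Tendsto (fun n : ℕ =>
        (∑ m ∈ Ioc 0 (6 * n), (if m % 6 = a % 6 then 1 else 0) * (m.totient : ℝ))
          / (6 * (n : ℝ)) ^ 2)
      atTop (nhds (3 / (4 * π ^ 2))) := by
  have hlim : 3 / (4 * π ^ 2) = ∑' d : ℕ,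
      1 / 12 * (if d.Coprime 6 then (μ d : ℝ) / (d : ℝ) ^ 2 else 0) := by
    rw [tsum_mul_left, tsum_coprime_six_moebius_div_sq]
    ring
  set F : ℕ → ℕ → ℝ := fun n d => if d.Coprime 6 then
    (μ d : ℝ) * ((sumModSix (d * a % 6) (6 * n / d) : ℝ) / (6 * (n : ℝ)) ^ 2) else 0 with hF
  have hsum : ∀ n : ℕ,
      (∑ m ∈ Ioc 0 (6 * n), (if m % 6 = a % 6 then 1 else 0) * (m.totient : ℝ))
          / (6 * (n : ℝ)) ^ 2 = ∑' d, F n d := by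
    intro n
    rw [sum_Ioc_mul_totient, tsum_eq_sum (s := Ioc 0 (6 * n)), Finset.sum_div]
    · refine Finset.sum_congr rfl fun d _ => ?_
      have h := congrArg (Nat.cast (R := ℝ)) (sum_Ioc_ite_mul_mod_six (d := d) ha (6 * n / d))
      push_cast at h
      simp only [ite_mul, one_mul, zero_mul, h, hF]
      split_ifs <;> ring
    · intro d hd
      have hd' : 6 * n / d = 0 := by
        rw [Finset.mem_Ioc] at hd
        rcases Nat.eq_zero_or_pos d with rfl | h
        · simp
        · exact Nat.div_eq_of_lt (by omega)
      simp [hF, hd', sumModSix]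
  simp only [hsum]
  rw [hlim]
  refine tendsto_tsum_of_dominated_convergence (bound := fun d : ℕ => 1 / (d : ℝ) ^ 2)
    (Real.summable_one_div_nat_pow.2 one_lt_two) (fun d => ?_) (Eventually.of_forall fun n d => ?_)
  · simp only [hF]
    split_ifs
    · convert (tendsto_sumModSix_div (Nat.mod_lt (d * a) (by norm_num : 6 > 0)) d).const_mul
        (μ d : ℝ) using 2
      ring
    · simp
  · simp only [hF]
    split_ifs
    · have hmu : |(μ d : ℝ)| ≤ 1 := mod_cast ArithmeticFunction.abs_moebius_le_one
      rw [norm_mul, Real.norm_eq_abs, Real.norm_of_nonneg (by positivity)]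
      refine (mul_le_of_le_one_left (by positivity) hmu).trans ?_
      refine div_le_of_le_mul₀ (by positivity) (by positivity) ?_
      have h1 : (sumModSix (d * a % 6) (6 * n / d) : ℝ) ≤ ((6 * n / d : ℕ) : ℝ) ^ 2 :=
        mod_cast sumModSix_le_sq _ _
      refine h1.trans ?_
      have h2 : ((6 * n / d : ℕ) : ℝ) ≤ 6 * n / d := by
        simpa using Nat.cast_div_le (α := ℝ) (m := 6 * n) (n := d)
      calc ((6 * n / d : ℕ) : ℝ) ^ 2 ≤ (6 * n / d : ℝ) ^ 2 := by gcongr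
        _ = _ := by ring
    · simp

lemma sum_Icc_six_mul_sub {c : ℕ} (hc : c < 6) (f : ℕ → ℝ) (n : ℕ) :
    ∑ k ∈ Finset.Icc 1 n, f (6 * k - c) =
      ∑ m ∈ Ioc 0 (6 * n), (if m % 6 = (6 - c) % 6 then 1 else 0) * f m := by
  induction n with
  | zero => simp
  | succ n ih =>
    rw [Finset.sum_Icc_succ_top (by omega), ih, mul_add, mul_one, sum_Ioc_zero_add_six]
    interval_cases c <;> simp [Nat.add_mod]

theorem phi_sum_6k_sub_5_and_6k_sub_1_limit :
    Tendsto (fun n : ℕ =>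
        (∑ k ∈ Finset.Icc 1 n, (Nat.totient (6 * k - 5) : ℝ)) / (6 * (n : ℝ)) ^ 2)
      atTop (nhds (3 / (4 * π ^ 2))) ∧
    Tendsto (fun n : ℕ =>
        (∑ k ∈ Finset.Icc 1 n, (Nat.totient (6 * k - 1) : ℝ)) / (6 * (n : ℝ)) ^ 2)
      atTop (nhds (3 / (4 * π ^ 2))) := by
  constructor
  · simp only [sum_Icc_six_mul_sub (by norm_num : 5 < 6) fun m => (m.totient : ℝ)]
    exact tendsto_sum_totient_mod_six (by norm_num)
  · simp only [sum_Icc_six_mul_sub (by norm_num : 1 < 6) fun m => (m.totient : ℝ)]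
    exact tendsto_sum_totient_mod_six (by norm_num)
end
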